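/- For each residue function r̃ : ℕ_{>1} → ℕ, the theory T_r̃ is a completion (i.e. a consistent complete extension) of T_MSO(Fin); moreover, every completion of T_MSO(Fin) that has an infinite model is equal to T_r̃ for some residue function r̃. -/

import Mathlib

open FirstOrder FirstOrder.Language

namespace MSO

/-! ### The language `L_⊗` and its semantics -/

/-- The language `L_⊗`: a constant `⊥`, a unary relation `At`,
and two binary relations: `⊆` (encoded `true`) and `≤ᴱ` (encoded `false`). -/
def Lmso : Language where
  Functions := fun n => match n with | 0 => Unit | _ => Empty
  Relations := fun n => match n with | 1 => Unit | 2 => Bool | _ => Empty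

/-- The constant symbol `⊥`. -/
def botC : Lmso.Constants := Unit.unit
/-- The unary relation symbol `At`. -/
def atR : Lmso.Relations 1 := Unit.unit
/-- The binary relation symbol `⊆`. -/
def subR : Lmso.Relations 2 := true
/-- The binary relation symbol `≤ᴱ`. -/
def exleR : Lmso.Relations 2 := false

/-- The interpretation of `⊥` in an `L_⊗`-structure. -/
def botE (M : Type*) [Lmso.Structure M] : M := Structure.funMap botC ![]
/-- The interpretation of `At` in an `L_⊗`-structure. -/
def atE {M : Type*} [Lmso.Structure M] (a : M) : Prop := Structure.RelMap atR ![a]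
/-- The interpretation of `⊆` in an `L_⊗`-structure. -/
def subE {M : Type*} [Lmso.Structure M] (a b : M) : Prop := Structure.RelMap subR ![a, b]
/-- The interpretation of `≤ᴱ` in an `L_⊗`-structure. -/
def exleE {M : Type*} [Lmso.Structure M] (a b : M) : Prop := Structure.RelMap exleR ![a, b]

/-- The monadic second order version `M̃SO(α)` of a linear order `α`, as an `L_⊗`-structure:
the universe is the powerset of `α`, `⊆` is inclusion, `⊥` is `∅`, `At` holds of singletons,
and `A ≤ᴱ B` iff there are `a ∈ A` and `b ∈ B` with `a < b`. -/
instance msoStructure (α : Type*) [LinearOrder α] : Lmso.Structure (Set α) where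
  funMap := fun {n} f _ => match n, f with
    | 0, _ => (∅ : Set α)
  RelMap := fun {n} r v => match n, r with
    | 1, _ => ∃ a : α, v 0 = {a}
    | 2, true => v 0 ⊆ v 1
    | 2, false => ∃ a ∈ v 0, ∃ b ∈ v 1, a < b

/-- `MSO(n)`, the monadic second order version of the `n`-element linear order. -/
abbrev MSOn (n : ℕ) : Type := Set (Fin n)

/-- The operation `⊗` on `L_⊗`-structures: the universe is the product, `⊆` is componentwise,
`⊥` is the pair of bottoms, `At` holds of the atoms (minimal non-bottom elements) of the
resulting order, and `(A,B) ≤ᴱ (C,D)` iff (`A ≠ ⊥` and `D ≠ ⊥`), or `A ≤ᴱ C`, or `B ≤ᴱ D`. -/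
instance tensorStructure (M N : Type*) [Lmso.Structure M] [Lmso.Structure N] :
    Lmso.Structure (M × N) where
  funMap := fun {n} f _ => match n, f with
    | 0, _ => (botE M, botE N)
  RelMap := fun {n} r v => match n, r with
    | 1, _ => v 0 ≠ (botE M, botE N) ∧
        ∀ q : M × N, subE q.1 (v 0).1 → subE q.2 (v 0).2 →
          q = (botE M, botE N) ∨ q = v 0
    | 2, true => subE (v 0).1 (v 1).1 ∧ subE (v 0).2 (v 1).2
    | 2, false => ((v 0).1 ≠ botE M ∧ (v 1).2 ≠ botE N) ∨
        exleE (v 0).1 (v 1).1 ∨ exleE (v 0).2 (v 1).2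

/-! ### Formulas -/

/-- Bounded `L_⊗`-formulas with no free (outer) variables. -/
abbrev BF (n : ℕ) := Lmso.BoundedFormula Empty n

/-- The `i`-th de Bruijn variable as a term. -/
def tv {n : ℕ} (i : Fin n) : Lmso.Term (Empty ⊕ Fin n) := Term.var (Sum.inr i)
/-- The constant `⊥` as a term. -/
def tb {n : ℕ} : Lmso.Term (Empty ⊕ Fin n) := Constants.term botC

def sub' {n : ℕ} (i j : Fin n) : BF n := subR.boundedFormula₂ (tv i) (tv j)
def exle' {n : ℕ} (i j : Fin n) : BF n := exleR.boundedFormula₂ (tv i) (tv j)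
def at' {n : ℕ} (i : Fin n) : BF n := atR.boundedFormula₁ (tv i)
def eq' {n : ℕ} (i j : Fin n) : BF n := Term.bdEqual (tv i) (tv j)
def isBot' {n : ℕ} (i : Fin n) : BF n := Term.bdEqual (tv i) tb
def botSub' {n : ℕ} (i : Fin n) : BF n := subR.boundedFormula₂ tb (tv i)

/-- Finite conjunction. -/
def bigAnd {n : ℕ} (l : List (BF n)) : BF n := l.foldr (· ⊓ ·) ⊤
/-- Finite disjunction. -/
def bigOr {n : ℕ} (l : List (BF n)) : BF n := l.foldr (· ⊔ ·) ⊥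

/-- `k` is the meet of `i` and `j` (with respect to `⊆`). -/
def isMeet {n : ℕ} (k i j : Fin n) : BF n :=
  sub' k i ⊓ sub' k j ⊓
    ∀' ((sub' (Fin.last n) i.castSucc ⊓ sub' (Fin.last n) j.castSucc) ⟹
      sub' (Fin.last n) k.castSucc)

/-- `k` is the join of `i` and `j` (with respect to `⊆`). -/
def isJoin {n : ℕ} (k i j : Fin n) : BF n :=
  sub' i k ⊓ sub' j k ⊓
    ∀' ((sub' i.castSucc (Fin.last n) ⊓ sub' j.castSucc (Fin.last n)) ⟹
      sub' k.castSucc (Fin.last n))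

/-- The meet of `i` and `j` is `⊥`. -/
def meetIsBot {n : ℕ} (i j : Fin n) : BF n :=
  ∀' ((sub' (Fin.last n) i.castSucc ⊓ sub' (Fin.last n) j.castSucc) ⟹ isBot' (Fin.last n))

/-- The join of `i` and `j` is the top element. -/
def joinIsTop {n : ℕ} (i j : Fin n) : BF n :=
  ∀' ((sub' i.castSucc (Fin.last n) ⊓ sub' j.castSucc (Fin.last n)) ⟹
    ∀' (sub' (Fin.last (n + 1)) ((Fin.last n).castSucc)))

/-- `j` is a (Boolean) complement of `i`. -/
def isComplOf {n : ℕ} (j i : Fin n) : BF n := meetIsBot i j ⊓ joinIsTop i j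

/-- `i` is an atom: non-bottom, and minimal among non-bottom elements. -/
def isAtomDef {n : ℕ} (i : Fin n) : BF n :=
  ∼(isBot' i) ⊓
    ∀' (sub' (Fin.last n) i.castSucc ⟹ (isBot' (Fin.last n) ⊔ eq' (Fin.last n) i.castSucc))

/-! ### The base theory `T_base` -/

def axRefl : Lmso.Sentence := ∀' sub' 0 0
def axAntisymm : Lmso.Sentence := ∀' ∀' ((sub' 0 1 ⊓ sub' 1 0) ⟹ eq' 0 1)
def axTrans : Lmso.Sentence := ∀' ∀' ∀' ((sub' 0 1 ⊓ sub' 1 2) ⟹ sub' 0 2)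
def axBotLe : Lmso.Sentence := ∀' botSub' 0
def axTop : Lmso.Sentence := ∃' ∀' (sub' 1 0)
def axMeet : Lmso.Sentence := ∀' ∀' ∃' (isMeet 2 0 1)
def axJoin : Lmso.Sentence := ∀' ∀' ∃' (isJoin 2 0 1)
def axCompl : Lmso.Sentence := ∀' ∃' (isComplOf 1 0)
def axDistrib : Lmso.Sentence :=
  ∀' ∀' ∀' ∀' ∀' ∀' ∀' ∀'
    ((isMeet 3 0 1 ⊓ isMeet 4 0 2 ⊓ isJoin 5 1 2 ⊓ isMeet 6 0 5 ⊓ isJoin 7 3 4) ⟹ sub' 6 7)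
def axAt : Lmso.Sentence := ∀' (at' 0 ⇔ isAtomDef 0)
def axAtomic : Lmso.Sentence := ∀' (∼(isBot' 0) ⟹ ∃' (at' 1 ⊓ sub' 1 0))
def axIrrefl : Lmso.Sentence := ∀' (at' 0 ⟹ ∼(exle' 0 0))
def axTransAt : Lmso.Sentence :=
  ∀' ∀' ∀' ((at' 0 ⊓ at' 1 ⊓ at' 2 ⊓ exle' 0 1 ⊓ exle' 1 2) ⟹ exle' 0 2)
def axTrich : Lmso.Sentence :=
  ∀' ∀' ((at' 0 ⊓ at' 1) ⟹ (exle' 0 1 ⊔ eq' 0 1 ⊔ exle' 1 0))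
def axExleDef : Lmso.Sentence :=
  ∀' ∀' (exle' 0 1 ⇔ ∃' ∃' (at' 2 ⊓ at' 3 ⊓ sub' 2 0 ⊓ sub' 3 1 ⊓ exle' 2 3))

/-- The comprehension axiom for a formula `η(x; Y₁,…,Yₙ)` (with `x` the last variable):
`∀ Ȳ ∃ X ∀ x (At x → (x ⊆ X ↔ η(x; Ȳ)))`. -/
def compAx {n : ℕ} (η : BF (n + 1)) : Lmso.Sentence :=
  BoundedFormula.alls (∃' ∀' (at' (Fin.last (n + 1)) ⟹
    (sub' (Fin.last (n + 1)) ((Fin.last n).castSucc) ⇔ η.liftAt 1 n)))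

/-- The base theory `T_base`: an atomic Boolean algebra under `⊆` with bottom `⊥`, `At`
holding exactly of the atoms, `≤ᴱ` linearly ordering the atoms and determined by its
restriction to the atoms, together with the comprehension scheme. -/
def Tbase : Lmso.Theory :=
  {axRefl, axAntisymm, axTrans, axBotLe, axTop, axMeet, axJoin, axCompl, axDistrib,
    axAt, axAtomic, axIrrefl, axTransAt, axTrich, axExleDef} ∪
  ⋃ n : ℕ, Set.range (compAx (n := n))

/-! ### The theory `T_MSO(Fin)` -/

/-- `i` is the `≤ᴱ`-least atom. -/
def isLeastAtom {n : ℕ} (i : Fin n) : BF n :=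
  at' i ⊓ ∀' (at' (Fin.last n) ⟹ ∼(exle' (Fin.last n) i.castSucc))

/-- `i` is the `≤ᴱ`-greatest atom. -/
def isGreatestAtom {n : ℕ} (i : Fin n) : BF n :=
  at' i ⊓ ∀' (at' (Fin.last n) ⟹ ∼(exle' i.castSucc (Fin.last n)))

/-- `j` is the immediate `≤ᴱ`-successor of the atom `i`. -/
def isSuccOf {n : ℕ} (j i : Fin n) : BF n :=
  at' i ⊓ at' j ⊓ exle' i j ⊓
    ∀' ((at' (Fin.last n) ⊓ exle' i.castSucc (Fin.last n)) ⟹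
      (eq' (Fin.last n) j.castSucc ⊔ exle' j.castSucc (Fin.last n)))

def axLeastAtom : Lmso.Sentence := (∃' at' 0) ⟹ ∃' isLeastAtom 0
def axGreatestAtom : Lmso.Sentence := (∃' at' 0) ⟹ ∃' isGreatestAtom 0
def axSucc : Lmso.Sentence :=
  ∀' ((at' 0 ⊓ ∃' (at' 1 ⊓ exle' 0 1)) ⟹ ∃' isSuccOf 1 0)
def axPred : Lmso.Sentence :=
  ∀' ((at' 0 ⊓ ∃' (at' 1 ⊓ exle' 1 0)) ⟹ ∃' isSuccOf 0 1)
def axLeastIn : Lmso.Sentence :=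
  ∀' (∼(isBot' 0) ⟹ ∃' (at' 1 ⊓ sub' 1 0 ⊓ ∀' ((at' 2 ⊓ sub' 2 0) ⟹ ∼(exle' 2 1))))

/-- The theory `T_MSO(Fin)`: `T_base` together with axioms saying that the ordering of the
atoms is discrete with endpoints, and every non-bottom element contains a least atom. -/
def TMSOFin : Lmso.Theory :=
  Tbase ∪ {axLeastAtom, axGreatestAtom, axSucc, axPred, axLeastIn}

/-! ### Quantifier rank, unnested formulas, and `≈ₖ` -/

/-- Quantifier rank of a bounded formula. -/
def qr : ∀ {n : ℕ}, BF n → ℕ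
  | _, BoundedFormula.falsum => 0
  | _, BoundedFormula.equal _ _ => 0
  | _, BoundedFormula.rel _ _ => 0
  | _, BoundedFormula.imp f g => max (qr f) (qr g)
  | _, BoundedFormula.all f => qr f + 1

/-- A formula is unnested if every atomic subformula is of one of the forms
`x = y`, `c = y`, or `R x̄` with the `xᵢ`, `y` variables (Hodges). -/
def IsUnnested : ∀ {n : ℕ}, BF n → Prop
  | _, BoundedFormula.falsum => True
  | _, BoundedFormula.equal s t =>
      (∃ i j, s = Term.var i ∧ t = Term.var j) ∨
      (∃ (c : Lmso.Constants) (j : _), s = Constants.term c ∧ t = Term.var j)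
  | _, BoundedFormula.rel _ ts => ∀ i, ∃ j, ts i = Term.var j
  | _, BoundedFormula.imp f g => IsUnnested f ∧ IsUnnested g
  | _, BoundedFormula.all f => IsUnnested f

/-- `M ≈ₖ N` : `M` and `N` satisfy the same unnested `L_⊗`-sentences of quantifier
rank at most `k`. -/
def EquivK (k : ℕ) (M N : Type*) [Lmso.Structure M] [Lmso.Structure N] : Prop :=
  ∀ φ : Lmso.Sentence, IsUnnested φ → qr φ ≤ k → (M ⊨ φ ↔ N ⊨ φ)

/-! ### The sentences `ρ_{d,h}`, `ψ_{>n}`, `ψ_{=n}` -/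

/-- The index (in `Fin d`) of `A_h` among `A₁, …, A_d`, identifying `h = 0` with `h = d`. -/
def aIdx (d h : ℕ) (hd : 0 < d) : Fin d := ⟨(h + d - 1) % d, Nat.mod_lt _ hd⟩

/-- The cyclic successor on the indices `{1, …, d}`. -/
def cyc {d : ℕ} (j : Fin d) : Fin d := ⟨((j : ℕ) + 1) % d, Nat.mod_lt _ j.pos⟩

/-- The sentence `ρ_{d,h}`: there is a partition of the atoms into `d` non-bottom elements
`A₁, …, A_d` such that the least atom is in `A₁`, the immediate successor of an atom lying in
`A_j` lies in `A_{j+1}` (cyclically), and the greatest atom is in `A_h`. -/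
def rho (d h : ℕ) : Lmso.Sentence :=
  if hd : 0 < d then
    BoundedFormula.exs (n := d) (
      -- each `A_i` is non-bottom
      bigAnd ((List.finRange d).map fun i => ∼(isBot' i)) ⊓
      -- every atom lies in some `A_i`
      (∀' (at' (Fin.last d) ⟹
        bigOr ((List.finRange d).map fun i => sub' (Fin.last d) i.castSucc))) ⊓
      -- the `A_i` are pairwise disjoint on atoms
      bigAnd ((List.finRange d).flatMap fun i => (List.finRange d).filterMap fun j =>
        if i.val < j.val then
          some (∀' (at' (Fin.last d) ⟹
            ∼(sub' (Fin.last d) i.castSucc ⊓ sub' (Fin.last d) j.castSucc)))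
        else none) ⊓
      -- the least atom lies in `A₁`
      (∀' (isLeastAtom (Fin.last d) ⟹ sub' (Fin.last d) ((aIdx d 1 hd).castSucc))) ⊓
      -- immediate successors move cyclically through the `A_j`
      bigAnd ((List.finRange d).map fun j =>
        ∀' ∀' ((sub' ((Fin.last d).castSucc) (j.castSucc.castSucc) ⊓
            isSuccOf (Fin.last (d + 1)) ((Fin.last d).castSucc)) ⟹
          sub' (Fin.last (d + 1)) ((cyc j).castSucc.castSucc))) ⊓
      -- the greatest atom lies in `A_h`
      (∀' (isGreatestAtom (Fin.last d) ⟹ sub' (Fin.last d) ((aIdx d h hd).castSucc))))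
  else ⊥

/-- The list of formulas `xᵢ ≠ xⱼ` for `i < j < n`. -/
def distinctPairs (n : ℕ) : List (BF n) :=
  (List.finRange n).flatMap fun i => (List.finRange n).filterMap fun j =>
    if i.val < j.val then some (∼(eq' i j)) else none

/-- `ψ_{>n}` : there exist at least `n + 1` distinct atoms. -/
def psiGt (n : ℕ) : Lmso.Sentence :=
  BoundedFormula.exs (n := n + 1)
    (bigAnd ((List.finRange (n + 1)).map fun i => at' i) ⊓ bigAnd (distinctPairs (n + 1)))

/-- `ψ_{=n}` : there exist exactly `n` distinct atoms. -/
def psiEq (n : ℕ) : Lmso.Sentence :=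
  BoundedFormula.exs (n := n)
    (bigAnd ((List.finRange n).map fun i => at' i) ⊓ bigAnd (distinctPairs n) ⊓
      ∀' (at' (Fin.last n) ⟹ bigOr ((List.finRange n).map fun i => eq' (Fin.last n) i.castSucc)))

/-! ### Residue functions and the theories `T_r̃` -/

/-- A residue function `ℙ × ℕ_{>0} → ℕ` (conditions imposed only at primes `p` and `j ≥ 1`):
`r(p,j) < p^j` and `r(p,j+1) ≡ r(p,j) [MOD p^j]`. -/
def IsResidueFunction (r : ℕ → ℕ → ℕ) : Prop :=
  ∀ p j : ℕ, p.Prime → 1 ≤ j → r p j < p ^ j ∧ r p (j + 1) ≡ r p j [MOD p ^ j]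

/-- A function `ℕ_{>1} → ℕ` is a residue function if it arises from a residue function
`ℙ × ℕ_{>0} → ℕ` as in the paper (conditions imposed only for `d > 1`). -/
def IsResidueFunctionTilde (rt : ℕ → ℕ) : Prop :=
  ∃ r : ℕ → ℕ → ℕ, IsResidueFunction r ∧
    ∀ d : ℕ, 1 < d → rt d < d ∧
      ∀ p j : ℕ, p.Prime → 1 ≤ j → p ^ j ∣ d → rt d ≡ r p j [MOD p ^ j]

/-- The theory `T_r̃ = T_MSO(Fin) ∪ {ψ_{>n} : n ∈ ℕ} ∪ {ρ_{d,r̃(d)} : d > 1}`. -/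
def Trt (rt : ℕ → ℕ) : Lmso.Theory :=
  TMSOFin ∪ Set.range psiGt ∪ {σ : Lmso.Sentence | ∃ d : ℕ, 1 < d ∧ σ = rho d (rt d)}

/-! ### Relativization and the sum of sentences -/

/-- Relativization of a formula to the elements `⊆ v`:
each quantifier `∀ Z (…)` becomes `∀ Z (Z ⊆ v → …)`. -/
def relv : ∀ {n : ℕ}, BF n → Fin n → BF n
  | _, BoundedFormula.falsum, _ => BoundedFormula.falsum
  | _, BoundedFormula.equal s t, _ => BoundedFormula.equal s t
  | _, BoundedFormula.rel r ts, _ => BoundedFormula.rel r ts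
  | _, BoundedFormula.imp f g, v => (relv f v).imp (relv g v)
  | n, BoundedFormula.all f, v =>
      BoundedFormula.all (sub' (Fin.last n) v.castSucc ⟹ relv f v.castSucc)

/-- `i` is downward closed with respect to the `≤ᴱ`-ordering of the atoms. -/
def dwcl' {n : ℕ} (i : Fin n) : BF n :=
  ∀' ∀' ((at' ((Fin.last n).castSucc) ⊓ at' (Fin.last (n + 1)) ⊓
      sub' ((Fin.last n).castSucc) (i.castSucc.castSucc) ⊓
      exle' (Fin.last (n + 1)) ((Fin.last n).castSucc)) ⟹
    sub' (Fin.last (n + 1)) (i.castSucc.castSucc))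

/-- The sentence `φ + ψ` : `∃ X (X downward closed ∧ φ^X ∧ ψ^(Xᶜ))`
(with the complement `Xᶜ` introduced by an existential quantifier). -/
def plusSent (φ ψ : Lmso.Sentence) : Lmso.Sentence :=
  ∃' ∃' (dwcl' (0 : Fin 2) ⊓ isComplOf (1 : Fin 2) (0 : Fin 2) ⊓
    relv (φ.liftAt 2 0) (0 : Fin 2) ⊓ relv (ψ.liftAt 2 0) (1 : Fin 2))

/-! ### `FSpec` and ultimate periodicity -/

/-- `FSpec φ` : the set of `n ∈ ℕ` such that `MSO(n) ⊨ φ`. -/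
def FSpec (φ : Lmso.Sentence) : Set ℕ := {n : ℕ | MSOn n ⊨ φ}

/-- A set of naturals is ultimately periodic. -/
def UltPeriodic (S : Set ℕ) : Prop :=
  ∃ N d : ℕ, 0 < d ∧ ∀ n : ℕ, N < n → (n ∈ S ↔ n + d ∈ S)

/-! ### The language `L_MO = {⊆, <}` -/

/-- The language `L_MO` with two binary relations: `⊆` (encoded `true`) and `<`
(encoded `false`). -/
def Lmo : Language where
  Functions := fun _ => Empty
  Relations := fun n => match n with | 2 => Bool | _ => Empty

/-- The monadic second order version `MSO(α)` of a linear order `α` as an `L_MO`-structure: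
`⊆` is inclusion and `<` is the ordering of `α` on singletons. -/
instance moStructure (α : Type*) [LinearOrder α] : Lmo.Structure (Set α) where
  funMap := fun f _ => f.elim
  RelMap := fun {n} r v => match n, r with
    | 2, true => v 0 ⊆ v 1
    | 2, false => ∃ a b : α, v 0 = {a} ∧ v 1 = {b} ∧ a < b

section

/-! ### Realization of the basic formulas -/

variable {M : Type*} [Lmso.Structure M]

@[simp] theorem realize_sub' {n : ℕ} (i j : Fin n) (e : Empty → M) (v : Fin n → M) :
    (sub' i j).Realize e v ↔ subE (v i) (v j) := by
  simp [sub', subE, tv, BoundedFormula.realize_rel₂]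

@[simp] theorem realize_exle' {n : ℕ} (i j : Fin n) (e : Empty → M) (v : Fin n → M) :
    (exle' i j).Realize e v ↔ exleE (v i) (v j) := by
  simp [exle', exleE, tv, BoundedFormula.realize_rel₂]

@[simp] theorem realize_at' {n : ℕ} (i : Fin n) (e : Empty → M) (v : Fin n → M) :
    (at' i).Realize e v ↔ atE (v i) := by
  simp [at', atE, tv, BoundedFormula.realize_rel₁]

@[simp] theorem realize_eq' {n : ℕ} (i j : Fin n) (e : Empty → M) (v : Fin n → M) :
    (eq' i j).Realize e v ↔ v i = v j := by
  simp [eq', tv]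

@[simp] theorem realize_tb {n : ℕ} (w : Empty ⊕ Fin n → M) :
    (tb : Lmso.Term (Empty ⊕ Fin n)).realize w = botE M := by
  simp [tb, Constants.term, botE, Matrix.empty_eq]

@[simp] theorem realize_isBot' {n : ℕ} (i : Fin n) (e : Empty → M) (v : Fin n → M) :
    (isBot' i).Realize e v ↔ v i = botE M := by
  simp [isBot', tv]

@[simp] theorem realize_botSub' {n : ℕ} (i : Fin n) (e : Empty → M) (v : Fin n → M) :
    (botSub' i).Realize e v ↔ subE (botE M) (v i) := by
  simp [botSub', tv, subE, BoundedFormula.realize_rel₂]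

@[simp] theorem realize_bigAnd {n : ℕ} (l : List (BF n)) (e : Empty → M) (v : Fin n → M) :
    (bigAnd l).Realize e v ↔ ∀ φ ∈ l, φ.Realize e v := by
  simp [bigAnd]

@[simp] theorem realize_bigOr {n : ℕ} (l : List (BF n)) (e : Empty → M) (v : Fin n → M) :
    (bigOr l).Realize e v ↔ ∃ φ ∈ l, φ.Realize e v := by
  simp [bigOr]

@[simp] theorem realize_isMeet {n : ℕ} (k i j : Fin n) (e : Empty → M) (v : Fin n → M) :
    (isMeet k i j).Realize e v ↔ (subE (v k) (v i) ∧ subE (v k) (v j)) ∧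
      ∀ x, subE x (v i) ∧ subE x (v j) → subE x (v k) := by
  simp [isMeet]

@[simp] theorem realize_isJoin {n : ℕ} (k i j : Fin n) (e : Empty → M) (v : Fin n → M) :
    (isJoin k i j).Realize e v ↔ (subE (v i) (v k) ∧ subE (v j) (v k)) ∧
      ∀ x, subE (v i) x ∧ subE (v j) x → subE (v k) x := by
  simp [isJoin]

@[simp] theorem realize_isComplOf {n : ℕ} (j i : Fin n) (e : Empty → M) (v : Fin n → M) :
    (isComplOf j i).Realize e v ↔ (∀ x, subE x (v i) ∧ subE x (v j) → x = botE M) ∧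
      ∀ x, subE (v i) x ∧ subE (v j) x → ∀ y, subE y x := by
  simp [isComplOf, meetIsBot, joinIsTop]

@[simp] theorem realize_isAtomDef {n : ℕ} (i : Fin n) (e : Empty → M) (v : Fin n → M) :
    (isAtomDef i).Realize e v ↔ v i ≠ botE M ∧ ∀ x, subE x (v i) → x = botE M ∨ x = v i := by
  simp [isAtomDef]

@[simp] theorem realize_isLeastAtom {n : ℕ} (i : Fin n) (e : Empty → M) (v : Fin n → M) :
    (isLeastAtom i).Realize e v ↔ atE (v i) ∧ ∀ x, atE x → ¬ exleE x (v i) := by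
  simp [isLeastAtom]

@[simp] theorem realize_isGreatestAtom {n : ℕ} (i : Fin n) (e : Empty → M) (v : Fin n → M) :
    (isGreatestAtom i).Realize e v ↔ atE (v i) ∧ ∀ x, atE x → ¬ exleE (v i) x := by
  simp [isGreatestAtom]

@[simp] theorem realize_isSuccOf {n : ℕ} (j i : Fin n) (e : Empty → M) (v : Fin n → M) :
    (isSuccOf j i).Realize e v ↔ ((atE (v i) ∧ atE (v j)) ∧ exleE (v i) (v j)) ∧
      ∀ x, atE x ∧ exleE (v i) x → x = v j ∨ exleE (v j) x := by
  simp [isSuccOf]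

theorem realize_compAx {n : ℕ} (η : BF (n + 1)) : M ⊨ compAx η ↔
    ∀ v : Fin n → M, ∃ X, ∀ x, atE x →
      (subE x X ↔ η.Realize default (Fin.snoc v x : Fin (n + 1) → M)) := by
  refine BoundedFormula.realize_alls.trans ?_
  simp only [BoundedFormula.realize_all, BoundedFormula.realize_imp, BoundedFormula.realize_ex,
    BoundedFormula.realize_iff, realize_at', realize_sub']
  refine forall_congr' fun v => exists_congr fun X => forall_congr' fun x => ?_
  rw [BoundedFormula.realize_liftAt (by omega)]
  simp only [Fin.snoc_last, Fin.snoc_castSucc]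
  have : ((Fin.snoc (Fin.snoc v X : Fin (n + 1) → M) x : Fin (n + 1 + 1) → M) ∘
      fun i : Fin (n + 1) => if ↑i < n then Fin.castAdd 1 i else Fin.addNat i 1) =
      (Fin.snoc v x : Fin (n + 1) → M) := by
    funext i
    refine Fin.lastCases ?_ (fun i => ?_) i <;> simp [Fin.snoc]
  rw [this]

/-- The axioms of `T_MSO(Fin)`, read in a structure `M`. -/
structure FinAxioms (M : Type*) [Lmso.Structure M] : Prop where
  refl : ∀ a : M, subE a a
  antisymm : ∀ a b : M, subE a b ∧ subE b a → a = b
  trans : ∀ a b c : M, subE a b ∧ subE b c → subE a c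
  bot_le : ∀ a : M, subE (botE M) a
  top : ∃ a : M, ∀ b, subE b a
  meet : ∀ a b : M, ∃ p, (subE p a ∧ subE p b) ∧ ∀ x, subE x a ∧ subE x b → subE x p
  join : ∀ a b : M, ∃ p, (subE a p ∧ subE b p) ∧ ∀ x, subE a x ∧ subE b x → subE p x
  compl : ∀ a : M, ∃ b, (∀ x, subE x a ∧ subE x b → x = botE M) ∧
    ∀ x, subE a x ∧ subE b x → ∀ y, subE y x
  distrib : ∀ a b c p q s r t : M,
    ((((((subE p a ∧ subE p b) ∧ ∀ x, subE x a ∧ subE x b → subE x p) ∧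
    ((subE q a ∧ subE q c) ∧ ∀ x, subE x a ∧ subE x c → subE x q)) ∧
    ((subE b s ∧ subE c s) ∧ ∀ x, subE b x ∧ subE c x → subE s x)) ∧
    ((subE r a ∧ subE r s) ∧ ∀ x, subE x a ∧ subE x s → subE x r)) ∧
    ((subE p t ∧ subE q t) ∧ ∀ x, subE p x ∧ subE q x → subE t x)) → subE r t
  at_iff : ∀ a : M, atE a ↔ a ≠ botE M ∧ ∀ x, subE x a → x = botE M ∨ x = a
  atomic : ∀ a : M, ¬ a = botE M → ∃ b, atE b ∧ subE b a
  irrefl : ∀ a : M, atE a → ¬ exleE a a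
  lt_trans : ∀ a b c : M, (((atE a ∧ atE b) ∧ atE c) ∧ exleE a b) ∧ exleE b c → exleE a c
  trich : ∀ a b : M, atE a ∧ atE b → (exleE a b ∨ a = b) ∨ exleE b a
  exle_iff : ∀ a b : M, exleE a b ↔
    ∃ x y, (((atE x ∧ atE y) ∧ subE x a) ∧ subE y b) ∧ exleE x y
  comp : ∀ (n : ℕ) (η : BF (n + 1)) (v : Fin n → M), ∃ X, ∀ x, atE x →
    (subE x X ↔ η.Realize default (Fin.snoc v x : Fin (n + 1) → M))
  least : (∃ a : M, atE a) → ∃ a : M, atE a ∧ ∀ x, atE x → ¬ exleE x a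
  greatest : (∃ a : M, atE a) → ∃ a : M, atE a ∧ ∀ x, atE x → ¬ exleE a x
  succ : ∀ a : M, (atE a ∧ ∃ b, atE b ∧ exleE a b) →
    ∃ b, ((atE a ∧ atE b) ∧ exleE a b) ∧ ∀ x, atE x ∧ exleE a x → x = b ∨ exleE b x
  pred : ∀ a : M, (atE a ∧ ∃ b, atE b ∧ exleE b a) →
    ∃ b, ((atE b ∧ atE a) ∧ exleE b a) ∧ ∀ x, atE x ∧ exleE b x → x = a ∨ exleE a x
  least_in : ∀ a : M, ¬ a = botE M →
    ∃ b, (atE b ∧ subE b a) ∧ ∀ x, atE x ∧ subE x a → ¬ exleE x b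

theorem model_TMSOFin_iff : M ⊨ TMSOFin ↔ FinAxioms M := by
  rw [Theory.model_iff]
  simp only [TMSOFin, Tbase, Set.mem_union, Set.mem_insert_iff, Set.mem_singleton_iff,
    Set.mem_iUnion, Set.mem_range, or_imp, forall_and, forall_eq, forall_exists_index]
  have hcomp : (∀ (φ : Lmso.Sentence) (n : ℕ) (η : BF (n + 1)), compAx η = φ → M ⊨ φ) ↔
      ∀ (n : ℕ) (η : BF (n + 1)), M ⊨ compAx η :=
    ⟨fun h n η => h _ n η rfl, fun h _ n η e => e ▸ h n η⟩
  simp only [hcomp, realize_compAx]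
  simp only [axRefl, axAntisymm, axTrans, axBotLe, axTop, axMeet, axJoin, axCompl, axDistrib, axAt,
    axAtomic, axIrrefl, axTransAt, axTrich, axExleDef, axLeastAtom, axGreatestAtom, axSucc, axPred,
    axLeastIn, Sentence.Realize, Formula.Realize, BoundedFormula.realize_all,
    BoundedFormula.realize_imp, BoundedFormula.realize_inf, BoundedFormula.realize_sup,
    BoundedFormula.realize_not, BoundedFormula.realize_ex, BoundedFormula.realize_iff,
    realize_sub', realize_exle', realize_at', realize_eq', realize_isBot', realize_botSub',
    realize_isMeet, realize_isJoin, realize_isComplOf, realize_isAtomDef, realize_isLeastAtom,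
    realize_isGreatestAtom, realize_isSuccOf]
  constructor
  · rintro ⟨⟨⟨h1, h2, h3, h4, h5, h6, h7, h8, h9, h10, h11, h12, h13, h14, h15⟩, h16⟩,
      h17, h18, h19, h20, h21⟩
    exact ⟨h1, h2, h3, h4, h5, h6, h7, h8, h9, h10, h11, h12, h13, h14, h15, h16, h17, h18, h19,
      h20, h21⟩
  · rintro ⟨h1, h2, h3, h4, h5, h6, h7, h8, h9, h10, h11, h12, h13, h14, h15, h16, h17, h18, h19,
      h20, h21⟩
    exact ⟨⟨⟨h1, h2, h3, h4, h5, h6, h7, h8, h9, h10, h11, h12, h13, h14, h15⟩, h16⟩,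
      h17, h18, h19, h20, h21⟩

/-! ### Finite models -/

section Fin
variable {n : ℕ}

@[simp] theorem botE_MSOn : botE (MSOn n) = (∅ : Set (Fin n)) := rfl

@[simp] theorem subE_MSOn (a b : MSOn n) : subE a b ↔ a ⊆ b := Iff.rfl

@[simp] theorem atE_MSOn (a : MSOn n) : atE a ↔ ∃ i, a = {i} := Iff.rfl

@[simp] theorem exleE_MSOn (a b : MSOn n) : exleE a b ↔ ∃ i ∈ a, ∃ j ∈ b, i < j := Iff.rfl

theorem exleE_singleton (i j : Fin n) : exleE ({i} : MSOn n) {j} ↔ (i : ℕ) < j := by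
  simp

theorem finAxioms_MSOn (n : ℕ) : FinAxioms (MSOn n) where
  refl a := subset_rfl
  antisymm a b h := h.1.antisymm h.2
  trans a b c h := h.1.trans h.2
  bot_le a := Set.empty_subset a
  top := ⟨Set.univ, fun b => Set.subset_univ b⟩
  meet a b := ⟨a ∩ b, ⟨Set.inter_subset_left, Set.inter_subset_right⟩,
    fun x h => Set.subset_inter h.1 h.2⟩
  join a b := ⟨a ∪ b, ⟨Set.subset_union_left, Set.subset_union_right⟩,
    fun x h => Set.union_subset h.1 h.2⟩
  compl a := by
    refine ⟨aᶜ, fun x h => ?_, fun x h y i _ => ?_⟩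
    · exact Set.subset_empty_iff.1 fun i hi => h.2 hi (h.1 hi)
    · by_cases hi : i ∈ a
      exacts [h.1 hi, h.2 hi]
  distrib a b c p q s r t := by
    rintro ⟨⟨⟨⟨⟨-, hp⟩, -, hq⟩, -, hs⟩, hr, -⟩, ht, -⟩
    simp only [subE_MSOn] at *
    intro i hi
    have h1 := hs (b ∪ c) ⟨Set.subset_union_left, Set.subset_union_right⟩ (hr.2 hi)
    rcases h1 with h1 | h1
    · exact ht.1 (hp _ ⟨Set.inter_subset_left, Set.inter_subset_right⟩ ⟨hr.1 hi, h1⟩)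
    · exact ht.2 (hq _ ⟨Set.inter_subset_left, Set.inter_subset_right⟩ ⟨hr.1 hi, h1⟩)
  at_iff a := by
    simp only [atE_MSOn, botE_MSOn, subE_MSOn]
    constructor
    · rintro ⟨i, rfl⟩
      exact ⟨Set.singleton_ne_empty i, fun x => Set.subset_singleton_iff_eq.1⟩
    · rintro ⟨h, h'⟩
      obtain ⟨i, hi⟩ := Set.nonempty_iff_ne_empty.2 h
      exact ⟨i, ((h' {i} (Set.singleton_subset_iff.2 hi)).resolve_left
        (Set.singleton_ne_empty i)).symm⟩
  atomic a h := by
    obtain ⟨i, hi⟩ := Set.nonempty_iff_ne_empty.2 h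
    exact ⟨{i}, ⟨i, rfl⟩, Set.singleton_subset_iff.2 hi⟩
  irrefl := by
    rintro _ ⟨i, rfl⟩
    simp
  lt_trans := by
    rintro _ _ _ ⟨⟨⟨⟨⟨i, rfl⟩, j, rfl⟩, k, rfl⟩, h⟩, h'⟩
    simp only [exleE_MSOn, Set.mem_singleton_iff, exists_eq_left] at *
    exact h.trans h'
  trich := by
    rintro _ _ ⟨⟨i, rfl⟩, j, rfl⟩
    simp only [exleE_MSOn, Set.mem_singleton_iff, exists_eq_left, Set.singleton_eq_singleton_iff]
    exact or_assoc.2 (lt_trichotomy i j)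
  exle_iff a b := by
    constructor
    · rintro ⟨i, hi, j, hj, h⟩
      exact ⟨{i}, {j}, ⟨⟨⟨⟨i, rfl⟩, j, rfl⟩, Set.singleton_subset_iff.2 hi⟩,
        Set.singleton_subset_iff.2 hj⟩, i, rfl, j, rfl, h⟩
    · rintro ⟨_, _, ⟨⟨⟨⟨i, rfl⟩, j, rfl⟩, hi⟩, hj⟩, h⟩
      simp only [exleE_MSOn, Set.mem_singleton_iff, exists_eq_left] at h
      exact ⟨i, Set.singleton_subset_iff.1 hi, j, Set.singleton_subset_iff.1 hj, h⟩
  comp m η v := by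
    refine ⟨{i | η.Realize default (Fin.snoc v {i} : Fin (m + 1) → MSOn n)}, ?_⟩
    rintro _ ⟨i, rfl⟩
    rw [subE_MSOn, Set.singleton_subset_iff, Set.mem_ofPred_eq]
    exact iff_of_eq (congrArg (η.Realize · _) (Subsingleton.elim _ _))
  least := by
    rintro ⟨_, i, rfl⟩
    refine ⟨{⟨0, i.pos⟩}, ⟨_, rfl⟩, ?_⟩
    rintro _ ⟨j, rfl⟩
    simp only [exleE_singleton]
    omega
  greatest := by
    rintro ⟨_, i, rfl⟩
    refine ⟨{⟨n - 1, by have := i.pos; omega⟩}, ⟨_, rfl⟩, ?_⟩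
    rintro _ ⟨j, rfl⟩
    simp only [exleE_singleton]
    omega
  succ := by
    rintro _ ⟨⟨i, rfl⟩, _, ⟨j, rfl⟩, h⟩
    simp only [exleE_singleton] at h
    refine ⟨{⟨i + 1, by omega⟩}, ⟨⟨⟨_, rfl⟩, _, rfl⟩, ?_⟩, ?_⟩
    · simp only [exleE_singleton]
      omega
    · rintro _ ⟨⟨k, rfl⟩, h⟩
      simp only [exleE_singleton, Set.singleton_eq_singleton_iff, Fin.ext_iff] at *
      omega
  pred := by
    rintro _ ⟨⟨i, rfl⟩, _, ⟨j, rfl⟩, h⟩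
    simp only [exleE_singleton] at h
    refine ⟨{⟨i - 1, by omega⟩}, ⟨⟨⟨_, rfl⟩, _, rfl⟩, ?_⟩, ?_⟩
    · simp only [exleE_singleton]
      omega
    · rintro _ ⟨⟨k, rfl⟩, h⟩
      simp only [exleE_singleton, Set.singleton_eq_singleton_iff, Fin.ext_iff] at *
      omega
  least_in a h := by
    obtain ⟨i, hi⟩ := Set.nonempty_iff_ne_empty.2 h
    obtain ⟨j, hj, hmin⟩ := WellFounded.has_min (wellFounded_lt (α := Fin n)) a ⟨i, hi⟩
    refine ⟨{j}, ⟨⟨j, rfl⟩, Set.singleton_subset_iff.2 hj⟩, ?_⟩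
    rintro _ ⟨⟨k, rfl⟩, hk⟩
    simpa using hmin k (Set.singleton_subset_iff.1 hk)

end Fin

/-! ### Elements as sets of atoms -/

/-- The set of atoms below an element. -/
def ext (X : M) : Set M := {a | atE a ∧ subE a X}

namespace FinAxioms
variable (hM : FinAxioms M)
include hM

theorem ext_mono {X Y : M} (h : subE X Y) : ext X ⊆ ext Y :=
  fun a ha => ⟨ha.1, hM.trans a X Y ⟨ha.2, h⟩⟩

theorem eq_bot_of_subE {X : M} (h : subE X (botE M)) : X = botE M :=
  hM.antisymm _ _ ⟨h, hM.bot_le _⟩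

theorem eq_bot_iff {X : M} : X = botE M ↔ ext X = ∅ := by
  constructor
  · rintro rfl
    refine Set.eq_empty_iff_forall_notMem.2 fun a ha => ?_
    exact ((hM.at_iff a).1 ha.1).1 (hM.eq_bot_of_subE ha.2)
  · intro h
    by_contra hX
    obtain ⟨a, ha⟩ := hM.atomic X hX
    exact (Set.eq_empty_iff_forall_notMem.1 h) a ha

theorem ext_bot : ext (botE M) = ∅ := hM.eq_bot_iff.1 rfl

theorem subE_iff {X Y : M} : subE X Y ↔ ext X ⊆ ext Y := by
  refine ⟨hM.ext_mono, fun h => ?_⟩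
  obtain ⟨Y', hd, hj⟩ := hM.compl Y
  obtain ⟨p, hp⟩ := hM.meet X Y
  obtain ⟨q, hq⟩ := hM.meet X Y'
  obtain ⟨s, hs⟩ := hM.join Y Y'
  obtain ⟨r, hr⟩ := hM.meet X s
  obtain ⟨t, ht⟩ := hM.join p q
  have hrt := hM.distrib X Y Y' p q s r t ⟨⟨⟨⟨hp, hq⟩, hs⟩, hr⟩, ht⟩
  have hXr : subE X r := hr.2 X ⟨hM.refl X, hj s hs.1 X⟩
  have hqb : q = botE M := by
    rw [hM.eq_bot_iff, Set.eq_empty_iff_forall_notMem]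
    intro a ha
    have h1 := h (hM.ext_mono hq.1.1 ha)
    have h2 := hM.ext_mono hq.1.2 ha
    exact ((hM.at_iff a).1 ha.1).1 (hd a ⟨h1.2, h2.2⟩)
  have htY : subE t Y := ht.2 Y ⟨hp.1.2, hqb ▸ hM.bot_le Y⟩
  exact hM.trans _ _ _ ⟨hXr, hM.trans _ _ _ ⟨hrt, htY⟩⟩

theorem eq_iff {X Y : M} : X = Y ↔ ext X = ext Y :=
  ⟨fun h => h ▸ rfl, fun h => hM.antisymm _ _ ⟨hM.subE_iff.2 h.le, hM.subE_iff.2 h.ge⟩⟩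

theorem ext_atom {a : M} (ha : atE a) : ext a = {a} := by
  ext b
  constructor
  · rintro ⟨hb, hba⟩
    exact (((hM.at_iff a).1 ha).2 b hba).resolve_left ((hM.at_iff b).1 hb).1
  · rintro rfl
    exact ⟨ha, hM.refl _⟩

theorem atE_iff {X : M} : atE X ↔ ∃ a, ext X = {a} := by
  refine ⟨fun h => ⟨X, hM.ext_atom h⟩, ?_⟩
  rintro ⟨a, ha⟩
  have h : a ∈ ext X := ha ▸ rfl
  rw [hM.eq_iff.2 (ha.trans (hM.ext_atom h.1).symm)]
  exact h.1

theorem exleE_iff {X Y : M} : exleE X Y ↔ ∃ a ∈ ext X, ∃ b ∈ ext Y, exleE a b := by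
  rw [hM.exle_iff]
  constructor
  · rintro ⟨a, b, ⟨⟨⟨ha, hb⟩, hX⟩, hY⟩, h⟩
    exact ⟨a, ⟨ha, hX⟩, b, ⟨hb, hY⟩, h⟩
  · rintro ⟨a, ⟨ha, hX⟩, b, ⟨hb, hY⟩, h⟩
    exact ⟨a, b, ⟨⟨⟨ha, hb⟩, hX⟩, hY⟩, h⟩

end FinAxioms

/-! ### Definable predicates on tuples -/

/-- A predicate on `n`-tuples is definable without parameters. -/
def Dfn {n : ℕ} (P : (Fin n → M) → Prop) : Prop :=
  ∃ φ : BF n, ∀ v, φ.Realize default v ↔ P v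

namespace Dfn
variable {n : ℕ} {P Q : (Fin n → M) → Prop}

theorem congr (h : Dfn P) (e : ∀ v, P v ↔ Q v) : Dfn Q := by
  obtain ⟨φ, hφ⟩ := h
  exact ⟨φ, fun v => (hφ v).trans (e v)⟩

theorem sub (i j : Fin n) : Dfn fun v : Fin n → M => subE (v i) (v j) := ⟨sub' i j, by simp⟩

theorem exle (i j : Fin n) : Dfn fun v : Fin n → M => exleE (v i) (v j) := ⟨exle' i j, by simp⟩

theorem atom (i : Fin n) : Dfn fun v : Fin n → M => atE (v i) := ⟨at' i, by simp⟩

theorem eq (i j : Fin n) : Dfn fun v : Fin n → M => v i = v j := ⟨eq' i j, by simp⟩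

theorem const (p : Prop) : Dfn fun _ : Fin n → M => p := by
  by_cases h : p
  · exact ⟨⊤, by simp [h]⟩
  · exact ⟨⊥, by simp [h]⟩

theorem not (hP : Dfn P) : Dfn fun v => ¬ P v := by
  obtain ⟨φ, hφ⟩ := hP
  exact ⟨∼φ, by simp [hφ]⟩

theorem and (hP : Dfn P) (hQ : Dfn Q) : Dfn fun v => P v ∧ Q v := by
  obtain ⟨φ, hφ⟩ := hP
  obtain ⟨ψ, hψ⟩ := hQ
  exact ⟨φ ⊓ ψ, by simp [hφ, hψ]⟩

theorem imp (hP : Dfn P) (hQ : Dfn Q) : Dfn fun v => P v → Q v := by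
  obtain ⟨φ, hφ⟩ := hP
  obtain ⟨ψ, hψ⟩ := hQ
  exact ⟨φ.imp ψ, by simp [hφ, hψ]⟩

theorem iff (hP : Dfn P) (hQ : Dfn Q) : Dfn fun v => (P v ↔ Q v) :=
  ((hP.imp hQ).and (hQ.imp hP)).congr fun _ => iff_iff_implies_and_implies.symm

theorem ex {P : (Fin (n + 1) → M) → Prop} (hP : Dfn P) :
    Dfn fun v : Fin n → M => ∃ x, P (Fin.snoc v x : Fin (n + 1) → M) := by
  obtain ⟨φ, hφ⟩ := hP
  exact ⟨∃' φ, by simp [hφ]⟩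

theorem all {P : (Fin (n + 1) → M) → Prop} (hP : Dfn P) :
    Dfn fun v : Fin n → M => ∀ x, P (Fin.snoc v x : Fin (n + 1) → M) := by
  obtain ⟨φ, hφ⟩ := hP
  exact ⟨∀' φ, by simp [hφ]⟩

theorem forall_finite {ι : Type*} [Finite ι] {P : ι → (Fin n → M) → Prop} (h : ∀ i, Dfn (P i)) :
    Dfn fun v => ∀ i, P i v := by
  choose φ hφ using h
  exact ⟨BoundedFormula.iInf φ, by simp [hφ]⟩

end Dfn

/-! ### Types of bounded rank, restricted to a set of atoms -/

/-- Types of rank `k` of `n`-tuples. A type of rank `0` records inclusion, the order relation,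
emptiness and being a singleton; a type of rank `k + 1` is the set of the types of rank `k` of
the one-point extensions. -/
def Tp : ℕ → ℕ → Type
  | 0, n => ((Fin n → Fin n → Prop) × (Fin n → Fin n → Prop)) × ((Fin n → Prop) × (Fin n → Prop))
  | k + 1, n => Set (Tp k (n + 1))

instance finite_Tp : ∀ k n, Finite (Tp k n)
  | 0, n => by unfold Tp; infer_instance
  | k + 1, n => by
    have := finite_Tp k (n + 1)
    unfold Tp
    infer_instance

/-- The rank `k` type of a tuple, where every entry is restricted to the atoms in `C`. -/
def tp (C : Set M) : ∀ (k : ℕ) {n : ℕ}, (Fin n → M) → Tp k n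
  | 0, _, v => ((fun i j => ext (v i) ∩ C ⊆ ext (v j),
        fun i j => ∃ a ∈ ext (v i) ∩ C, ∃ b ∈ ext (v j) ∩ C, exleE a b),
      (fun i => ext (v i) ∩ C = ∅, fun i => ∃ a, ext (v i) ∩ C = {a}))
  | k + 1, _, v => Set.range fun x => tp C k (Fin.snoc v x)

/-- The type of any tuple restricted to the empty set of atoms. -/
def emptyTp : ∀ k n, Tp k n
  | 0, _ => ((fun _ _ => True, fun _ _ => False), (fun _ => True, fun _ => False))
  | k + 1, n => ({emptyTp k (n + 1)} : Set (Tp k (n + 1)))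

/-- The effect on types of adding one atom above all others; `β i` says whether the new atom
lies in the `i`-th entry. -/
def stepTp : ∀ (k : ℕ) {n : ℕ}, Tp k n → (Fin n → Prop) → Tp k n
  | 0, _, t, β => ((fun i j => t.1.1 i j ∧ (β i → β j), fun i j => t.1.2 i j ∨ (¬ t.2.1 i ∧ β j)),
      (fun i => t.2.1 i ∧ ¬ β i, fun i => (t.2.2 i ∧ ¬ β i) ∨ (t.2.1 i ∧ β i)))
  | k + 1, n, t, β => Set.image2 (γ := Tp k (n + 1))
      (fun u (b : Prop) => stepTp k u (Fin.snoc β b : Fin (n + 1) → Prop))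
      (t : Set (Tp k (n + 1))) Set.univ

theorem tp_empty : ∀ (k : ℕ) {n : ℕ} (v : Fin n → M), tp ∅ k v = emptyTp k n
  | 0, n, v => by
    simp only [tp, emptyTp, Set.inter_empty, Set.empty_subset, Set.mem_empty_iff_false, false_and,
      exists_false, Set.empty_ne_singleton]
    rfl
  | k + 1, n, v => by
    have : Nonempty M := ⟨botE M⟩
    simp only [tp, emptyTp, tp_empty k, Set.range_const]
    rfl

theorem tp_zero_eq_iff {N : Type*} [Lmso.Structure N] {C : Set M} {D : Set N} {n : ℕ}
    {v : Fin n → M} {w : Fin n → N} : tp C 0 v = tp D 0 w ↔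
      ((∀ i j, ext (v i) ∩ C ⊆ ext (v j) ↔ ext (w i) ∩ D ⊆ ext (w j)) ∧
        ∀ i j, (∃ a ∈ ext (v i) ∩ C, ∃ b ∈ ext (v j) ∩ C, exleE a b) ↔
          ∃ a ∈ ext (w i) ∩ D, ∃ b ∈ ext (w j) ∩ D, exleE a b) ∧
      (∀ i, ext (v i) ∩ C = ∅ ↔ ext (w i) ∩ D = ∅) ∧
        ∀ i, (∃ a, ext (v i) ∩ C = {a}) ↔ ∃ a, ext (w i) ∩ D = {a} := by
  refine Prod.mk_inj.trans ?_
  simp only [Prod.mk.injEq, funext_iff, eq_iff_iff]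

theorem tp_congr (C : Set M) : ∀ (k : ℕ) {n : ℕ} (v w : Fin n → M),
    (∀ i, ext (v i) ∩ C = ext (w i) ∩ C) → tp C k v = tp C k w
  | 0, n, v, w, h => by
    have h' : ∀ i j, ext (v i) ∩ C ⊆ ext (v j) ↔ ext (w i) ∩ C ⊆ ext (w j) := fun i j => by
      have e : ∀ X Y : Set M, X ∩ C ⊆ Y ↔ X ∩ C ⊆ Y ∩ C := fun X Y =>
        ⟨fun h => Set.subset_inter h Set.inter_subset_right,
          fun h => h.trans Set.inter_subset_left⟩
      rw [e, e (ext (w i)), h, h]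
    simp only [tp, h']
    simp only [h]
    rfl
  | k + 1, n, v, w, h => by
    simp only [tp]
    congr 1
    funext x
    refine tp_congr C k _ _ fun i => ?_
    refine Fin.lastCases ?_ (fun i => ?_) i
    · simp
    · simpa using h i

namespace FinAxioms
variable (hM : FinAxioms M)
include hM

theorem exists_ext_eq_insert (X : M) {b : M} (hb : atE b) : ∃ Y : M, ext Y = insert b (ext X) := by
  obtain ⟨Y, hY⟩ := hM.comp 2 (sub' 2 0 ⊔ eq' 2 1) ![X, b]
  refine ⟨Y, Set.ext fun a => ⟨fun ha => ?_, ?_⟩⟩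
  · have := (hY a ha.1).1 ha.2
    simp only [BoundedFormula.realize_sup, realize_sub', realize_eq'] at this
    exact this.symm.imp id fun h => ⟨ha.1, h⟩
  · intro ha
    have h1 : atE a := by
      rcases ha with rfl | ha
      exacts [hb, ha.1]
    refine ⟨h1, (hY a h1).2 ?_⟩
    simp only [BoundedFormula.realize_sup, realize_sub', realize_eq']
    exact ha.symm.imp And.right id

theorem exists_ext_eq_diff (X b : M) : ∃ Y : M, ext Y = ext X \ {b} := by
  obtain ⟨Y, hY⟩ := hM.comp 2 (sub' 2 0 ⊓ ∼(eq' 2 1)) ![X, b]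
  refine ⟨Y, Set.ext fun a => ⟨fun ha => ?_, fun ha => ?_⟩⟩
  · have := (hY a ha.1).1 ha.2
    simp only [BoundedFormula.realize_inf, realize_sub', realize_eq',
      BoundedFormula.realize_not] at this
    exact ⟨⟨ha.1, this.1⟩, this.2⟩
  · refine ⟨ha.1.1, (hY a ha.1.1).2 ?_⟩
    simp only [BoundedFormula.realize_inf, realize_sub', realize_eq', BoundedFormula.realize_not]
    exact ⟨ha.1.2, ha.2⟩

theorem tp_insert {C : Set M} {b : M} (hb : atE b) (hC : ∀ a ∈ C, atE a ∧ exleE a b) :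
    ∀ (k : ℕ) {n : ℕ} (v : Fin n → M),
      tp (insert b C) k v = stepTp k (tp C k v) fun i => b ∈ ext (v i)
  | 0, n, v => by
    have hbC : b ∉ C := fun h => hM.irrefl b hb (hC b h).2
    have key : ∀ X : M, ext X ∩ insert b C = (ext X ∩ C) ∪ {a | a = b ∧ b ∈ ext X} := by
      intro X
      ext a
      simp only [Set.mem_inter_iff, Set.mem_insert_iff, Set.mem_union, Set.mem_ofPred_eq]
      constructor
      · rintro ⟨h, rfl | h'⟩
        exacts [Or.inr ⟨rfl, h⟩, Or.inl ⟨h, h'⟩]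
      · rintro (⟨h, h'⟩ | ⟨rfl, h⟩)
        exacts [⟨h, Or.inr h'⟩, ⟨h, Or.inl rfl⟩]
    have hemp : ∀ X : M, ext X ∩ insert b C = ∅ ↔ ext X ∩ C = ∅ ∧ b ∉ ext X := by
      intro X
      rw [key, Set.union_empty_iff]
      refine and_congr_right fun _ => ?_
      simp [Set.eq_empty_iff_forall_notMem]
    refine Prod.ext (Prod.ext ?_ ?_) (Prod.ext ?_ ?_)
    · funext i j
      simp only [tp, stepTp, key, Set.union_subset_iff, eq_iff_iff]
      refine and_congr_right fun _ => ?_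
      exact ⟨fun h hi => h ⟨rfl, hi⟩, fun h a ha => ha.1 ▸ h ha.2⟩
    · funext i j
      simp only [tp, stepTp, key, eq_iff_iff]
      constructor
      · rintro ⟨x, hx | ⟨rfl, hx⟩, y, hy | ⟨rfl, hy⟩, hxy⟩
        · exact Or.inl ⟨x, hx, y, hy, hxy⟩
        · exact Or.inr ⟨(Set.nonempty_iff_ne_empty.1 ⟨x, hx⟩), hy⟩
        · exact (hM.irrefl x hb (hM.lt_trans x y x ⟨⟨⟨⟨hb, hy.1.1⟩, hb⟩, hxy⟩, (hC y hy.2).2⟩)).elim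
        · exact (hM.irrefl _ hb hxy).elim
      · rintro (⟨x, hx, y, hy, hxy⟩ | ⟨h, hj⟩)
        · exact ⟨x, Or.inl hx, y, Or.inl hy, hxy⟩
        · obtain ⟨x, hx⟩ := Set.nonempty_iff_ne_empty.2 h
          exact ⟨x, Or.inl hx, b, Or.inr ⟨rfl, hj⟩, (hC x hx.2).2⟩
    · funext i
      simp only [tp, stepTp, hemp]
    · funext i
      simp only [tp, stepTp, eq_iff_iff]
      by_cases hi : b ∈ ext (v i)
      · simp only [hi, not_true, and_false, and_true, false_or]
        constructor
        · rintro ⟨a, ha⟩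
          have hba : b ∈ ext (v i) ∩ insert b C := ⟨hi, Set.mem_insert _ _⟩
          rw [ha] at hba
          obtain rfl : b = a := hba
          refine Set.eq_empty_iff_forall_notMem.2 fun c hc => ?_
          have : c ∈ ext (v i) ∩ insert b C := ⟨hc.1, Or.inr hc.2⟩
          rw [ha] at this
          obtain rfl : c = b := this
          exact hbC hc.2
        · intro h
          exact ⟨b, by simp [key, h, hi]⟩
      · simp [hi, key]
  | k + 1, n, v => by
    have ih := fun x => tp_insert hb hC k (Fin.snoc v x : Fin (n + 1) → M)
    have hs : ∀ x : M, (fun i => b ∈ ext ((Fin.snoc v x : Fin (n + 1) → M) i)) =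
        (Fin.snoc (fun i => b ∈ ext (v i)) (b ∈ ext x) : Fin (n + 1) → Prop) := by
      intro x
      funext i
      refine Fin.lastCases ?_ (fun i => ?_) i <;> simp
    have hbC : b ∉ C := fun h => hM.irrefl b hb (hC b h).2
    have hex : ∀ (x : M) (p : Prop), ∃ y, ext y ∩ C = ext x ∩ C ∧ (b ∈ ext y ↔ p) := by
      intro x p
      by_cases hp : p
      · obtain ⟨y, hy⟩ := hM.exists_ext_eq_insert x hb
        exact ⟨y, by rw [hy, Set.insert_inter_of_notMem hbC], by simp [hy, hp]⟩
      · obtain ⟨y, hy⟩ := hM.exists_ext_eq_diff x b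
        refine ⟨y, ?_, by simp [hy, hp]⟩
        rw [hy, ← Set.inter_sdiff_right_comm, Set.sdiff_singleton_eq_self fun h => hbC h.2]
    simp only [tp, stepTp, ih, hs]
    refine Set.ext (α := Tp k (n + 1)) fun s => ⟨?_, ?_⟩
    · rintro ⟨x, rfl⟩
      exact ⟨_, ⟨x, rfl⟩, _, trivial, rfl⟩
    · rintro ⟨_, ⟨x, rfl⟩, p, -, rfl⟩
      obtain ⟨y, hy, hp⟩ := hex x p
      refine ⟨y, ?_⟩
      dsimp only
      rw [propext hp, tp_congr C k (Fin.snoc v y) (Fin.snoc v x)]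
      intro i
      refine Fin.lastCases ?_ (fun i => ?_) i <;> simp [hy]

end FinAxioms

/-! ### Types determine truth -/

variable {N : Type*} [Lmso.Structure N]

theorem tp_zero_eq (C : Set M) (D : Set N) :
    ∀ (k : ℕ) {n : ℕ} (v : Fin n → M) (w : Fin n → N), tp C k v = tp D k w → tp C 0 v = tp D 0 w
  | 0, _, _, _, h => h
  | k + 1, n, v, w, h => by
    have hr : (Set.range fun x => tp C k (Fin.snoc v x : Fin (n + 1) → M)) =
      Set.range fun x => tp D k (Fin.snoc w x : Fin (n + 1) → N) := h
    obtain ⟨y, hy⟩ := hr.le ⟨botE M, rfl⟩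
    have ih := tp_zero_eq C D k _ _ hy.symm
    rw [tp_zero_eq_iff] at ih ⊢
    obtain ⟨⟨h1, h2⟩, h3, h4⟩ := ih
    exact ⟨⟨fun i j => by simpa using h1 i.castSucc j.castSucc,
      fun i j => by simpa using h2 i.castSucc j.castSucc⟩,
      fun i => by simpa using h3 i.castSucc, fun i => by simpa using h4 i.castSucc⟩

theorem term_cases {n : ℕ} (t : Lmso.Term (Empty ⊕ Fin n)) :
    (∃ i, t = tv i) ∨ t = tb := by
  rcases t with ⟨a | i⟩ | @⟨l, f, ts⟩
  · exact a.elim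
  · exact Or.inl ⟨i, rfl⟩
  · right
    match l, f, ts with
    | 0, f, ts =>
      exact congrArg (Term.func f) (Subsingleton.elim _ _)

@[simp] theorem realize_tv {n : ℕ} (e : Empty → M) (v : Fin n → M) (i : Fin n) :
    (tv i).realize (Sum.elim e v) = v i := rfl

theorem realize_rel_one {n : ℕ} (R : Lmso.Relations 1) (ts : Fin 1 → Lmso.Term (Empty ⊕ Fin n))
    (e : Empty → M) (v : Fin n → M) : (BoundedFormula.rel R ts : BF n).Realize e v ↔
      atE ((ts 0).realize (Sum.elim e v)) := by
  change Structure.RelMap R (fun i => (ts i).realize _) ↔ Structure.RelMap R ![_]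
  exact iff_of_eq (congrArg _ (funext fun i => by rw [Subsingleton.elim i 0]; rfl))

theorem realize_rel_true {n : ℕ} (ts : Fin 2 → Lmso.Term (Empty ⊕ Fin n))
    (e : Empty → M) (v : Fin n → M) : (BoundedFormula.rel subR ts : BF n).Realize e v ↔
      subE ((ts 0).realize (Sum.elim e v)) ((ts 1).realize (Sum.elim e v)) := by
  change Structure.RelMap subR (fun i => (ts i).realize _) ↔ Structure.RelMap subR ![_, _]
  exact iff_of_eq (congrArg _ (List.ofFn_injective rfl))

theorem realize_rel_false {n : ℕ} (ts : Fin 2 → Lmso.Term (Empty ⊕ Fin n))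
    (e : Empty → M) (v : Fin n → M) : (BoundedFormula.rel exleR ts : BF n).Realize e v ↔
      exleE ((ts 0).realize (Sum.elim e v)) ((ts 1).realize (Sum.elim e v)) := by
  change Structure.RelMap exleR (fun i => (ts i).realize _) ↔ Structure.RelMap exleR ![_, _]
  exact iff_of_eq (congrArg _ (List.ofFn_injective rfl))

/-- The set of all atoms. -/
def atoms (M : Type*) [Lmso.Structure M] : Set M := {a | atE a}

theorem ext_inter_atoms (X : M) : ext X ∩ atoms M = ext X :=
  Set.inter_eq_left.2 fun _ ha => ha.1

theorem realize_iff_of_tp_eq (hM : FinAxioms M) (hN : FinAxioms N) {n : ℕ} (φ : BF n) :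
    ∀ (k : ℕ) (v : Fin n → M) (w : Fin n → N), qr φ ≤ k →
      tp (atoms M) k v = tp (atoms N) k w → (φ.Realize default v ↔ φ.Realize default w) := by
  induction φ with
  | falsum => exact fun _ _ _ _ _ => Iff.rfl
  | @equal n s t =>
    intro k v w _ h
    have h0 := tp_zero_eq_iff.1 (tp_zero_eq _ _ k v w h)
    simp only [ext_inter_atoms] at h0
    obtain ⟨⟨h1, h2⟩, h3, h4⟩ := h0
    change s.realize _ = t.realize _ ↔ s.realize _ = t.realize _
    have hbM : ∀ X : M, botE M = X ↔ X = botE M := fun X => eq_comm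
    have hbN : ∀ X : N, botE N = X ↔ X = botE N := fun X => eq_comm
    rcases term_cases s with ⟨i, rfl⟩ | rfl <;> rcases term_cases t with ⟨j, rfl⟩ | rfl
    · simp only [realize_tv, hM.eq_iff, hN.eq_iff, Set.Subset.antisymm_iff, h1]
    · simp only [realize_tv, realize_tb, hM.eq_bot_iff, hN.eq_bot_iff, h3]
    · simp only [realize_tv, realize_tb, hbM, hbN, hM.eq_bot_iff, hN.eq_bot_iff, h3]
    · simp only [realize_tb]
  | @rel n l R ts =>
    intro k v w _ h
    have h0 := tp_zero_eq_iff.1 (tp_zero_eq _ _ k v w h)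
    simp only [ext_inter_atoms] at h0
    obtain ⟨⟨h1, h2⟩, h3, h4⟩ := h0
    match l, R, ts with
    | 1, R, ts =>
      rw [realize_rel_one, realize_rel_one, hM.atE_iff, hN.atE_iff]
      rcases term_cases (ts 0) with ⟨i, hi⟩ | hi
      · simp only [hi, realize_tv, h4]
      · simp only [hi, realize_tb, hM.ext_bot, hN.ext_bot, Set.empty_ne_singleton, exists_false]
    | 2, true, ts =>
      refine (realize_rel_true ts default v).trans
        (Iff.trans ?_ (realize_rel_true ts default w).symm)
      rw [hM.subE_iff, hN.subE_iff]
      rcases term_cases (ts 0) with ⟨i, hi⟩ | hi <;> rcases term_cases (ts 1) with ⟨j, hj⟩ | hj <;>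
        simp only [hi, hj, realize_tv, realize_tb, hM.ext_bot, hN.ext_bot, h1, h3,
          Set.subset_empty_iff, Set.empty_subset]
    | 2, false, ts =>
      refine (realize_rel_false ts default v).trans
        (Iff.trans ?_ (realize_rel_false ts default w).symm)
      rw [hM.exleE_iff, hN.exleE_iff]
      rcases term_cases (ts 0) with ⟨i, hi⟩ | hi <;> rcases term_cases (ts 1) with ⟨j, hj⟩ | hj <;>
        simp only [hi, hj, realize_tv, realize_tb, hM.ext_bot, hN.ext_bot, h2,
          Set.mem_empty_iff_false, false_and, and_false, exists_false]
  | imp φ ψ ih1 ih2 =>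
    intro k v w hk h
    have hk' := max_le_iff.1 hk
    exact imp_congr (ih1 k v w hk'.1 h) (ih2 k v w hk'.2 h)
  | all φ ih =>
    intro k v w hk h
    obtain ⟨k, rfl⟩ : ∃ m, k = m + 1 := ⟨k - 1, by simp only [qr] at hk; omega⟩
    have hk' : qr φ ≤ k := by simp only [qr] at hk; omega
    have h' : (Set.range fun x => tp (atoms M) k (Fin.snoc v x)) =
      Set.range fun x => tp (atoms N) k (Fin.snoc w x) := h
    constructor
    · intro H y
      obtain ⟨x, hx⟩ := h'.ge ⟨y, rfl⟩
      exact (ih k _ _ hk' hx).1 (H x)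
    · intro H x
      obtain ⟨y, hy⟩ := h'.le ⟨x, rfl⟩
      exact (ih k _ _ hk' hy.symm).2 (H y)

/-! ### Every structure follows the orbit of the empty type -/

/-- The set of atoms `≤ᴱ b`. -/
def lower (b : M) : Set M := {c | atE c ∧ ¬ exleE b c}

theorem Dfn.mem_lower {n : ℕ} (a i z : Fin n) :
    Dfn fun v : Fin n → M => v a ∈ ext (v i) ∩ lower (v z) :=
  ((Dfn.atom a).and (Dfn.sub a i)).and ((Dfn.atom a).and (Dfn.exle z a).not)

theorem Dfn.tp_lower : ∀ (k : ℕ) {n : ℕ} (t : Tp k n),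
    Dfn fun v : Fin (n + 1) → M => tp (lower (v 0)) k (Fin.tail v) = t
  | 0, n, t => by
    have h1 : ∀ i j : Fin n, Dfn fun v : Fin (n + 1) → M =>
        ext (v i.succ) ∩ lower (v 0) ⊆ ext (v j.succ) := fun i j => by
      refine Dfn.congr (Dfn.all ((Dfn.mem_lower (Fin.last (n + 1)) i.succ.castSucc
        (Fin.castSucc 0)).imp ((Dfn.atom (Fin.last (n + 1))).and
          (Dfn.sub (Fin.last (n + 1)) j.succ.castSucc)))) fun v => ?_
      simp only [Fin.snoc_last, Fin.snoc_castSucc]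
      rfl
    have h2 : ∀ i j : Fin n, Dfn fun v : Fin (n + 1) → M =>
        ∃ a ∈ ext (v i.succ) ∩ lower (v 0), ∃ b ∈ ext (v j.succ) ∩ lower (v 0), exleE a b :=
      fun i j => by
      refine Dfn.congr (Dfn.ex ((Dfn.mem_lower (Fin.last (n + 1)) i.succ.castSucc
        (Fin.castSucc 0)).and (Dfn.ex ((Dfn.mem_lower (Fin.last (n + 2)) j.succ.castSucc.castSucc
          (Fin.castSucc (Fin.castSucc 0))).and
            (Dfn.exle (Fin.last (n + 1)).castSucc (Fin.last (n + 2))))))) fun v => ?_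
      simp only [Fin.snoc_last, Fin.snoc_castSucc]
    have h3 : ∀ i : Fin n, Dfn fun v : Fin (n + 1) → M => ext (v i.succ) ∩ lower (v 0) = ∅ :=
      fun i => by
      refine Dfn.congr (Dfn.all (Dfn.mem_lower (Fin.last (n + 1)) i.succ.castSucc
        (Fin.castSucc 0)).not) fun v => ?_
      simp only [Fin.snoc_last, Fin.snoc_castSucc, Set.eq_empty_iff_forall_notMem]
    have h4 : ∀ i : Fin n, Dfn fun v : Fin (n + 1) → M =>
        ∃ a, ext (v i.succ) ∩ lower (v 0) = {a} := fun i => by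
      refine Dfn.congr (Dfn.ex (Dfn.all ((Dfn.mem_lower (Fin.last (n + 2)) i.succ.castSucc.castSucc
        (Fin.castSucc (Fin.castSucc 0))).iff
          (Dfn.eq (Fin.last (n + 2)) (Fin.last (n + 1)).castSucc)))) fun v => ?_
      simp only [Fin.snoc_last, Fin.snoc_castSucc, Set.ext_iff, Set.mem_singleton_iff]
    refine Dfn.congr (((Dfn.forall_finite fun i => Dfn.forall_finite fun j =>
      (h1 i j).iff (Dfn.const (t.1.1 i j))).and (Dfn.forall_finite fun i =>
        Dfn.forall_finite fun j => (h2 i j).iff (Dfn.const (t.1.2 i j)))).and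
        ((Dfn.forall_finite fun i => (h3 i).iff (Dfn.const (t.2.1 i))).and
        (Dfn.forall_finite fun i => (h4 i).iff (Dfn.const (t.2.2 i))))) fun v => ?_
    obtain ⟨⟨t1, t2⟩, t3, t4⟩ := t
    refine Iff.trans ?_ Prod.mk_inj.symm
    simp only [Prod.mk.injEq, funext_iff, eq_iff_iff]
    rfl
  | k + 1, n, t => by
    have ih := fun s : Tp k (n + 1) => (Dfn.tp_lower k s).ex
    refine Dfn.congr (Dfn.forall_finite fun s => (ih s).iff
      (Dfn.const (Membership.mem (γ := Set (Tp k (n + 1))) t s))) fun v => ?_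
    have e : ∀ x : M, Fin.tail (Fin.snoc v x : Fin (n + 2) → M) =
        (Fin.snoc (Fin.tail v) x : Fin (n + 1) → M) := fun x => by
      funext i
      refine Fin.lastCases ?_ (fun i => ?_) i
      · simp [Fin.tail, Fin.succ_last]
      · simp only [Fin.tail, Fin.succ_castSucc, Fin.snoc_castSucc]
    have e0 : ∀ x : M, (Fin.snoc v x : Fin (n + 2) → M) 0 = v 0 := fun x =>
      Fin.snoc_castSucc (α := fun _ => M) x v 0
    simp only [e, e0]
    exact (Set.ext_iff (α := Tp k (n + 1))).symm

/-- The effect on types of the empty tuple of adding one atom above all others. -/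
def succTp (k : ℕ) (t : Tp k 0) : Tp k 0 := stepTp k t fun i => i.elim0

namespace FinAxioms
variable (hM : FinAxioms M)
include hM

theorem tp_insert_nil {C : Set M} {b : M} (hb : atE b) (hC : ∀ a ∈ C, atE a ∧ exleE a b) (k : ℕ) :
    tp (insert b C) k ![] = succTp k (tp C k ![]) := by
  rw [hM.tp_insert hb hC, succTp]
  congr 1
  funext i
  exact i.elim0

theorem exists_tp_lower (k : ℕ) (a : M) (ha : atE a) :
    ∃ n, tp (lower a) k ![] = (succTp k)^[n] (emptyTp k 0) := by
  have hd : Dfn fun v : Fin 1 → M =>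
      ∀ t : Tp k 0, tp (lower (v 0)) k (Fin.tail v) = t →
        ¬ ∃ n, t = (succTp k)^[n] (emptyTp k 0) :=
    Dfn.forall_finite fun t => (Dfn.tp_lower k t).imp (Dfn.const _)
  obtain ⟨φ, hφ⟩ := hd
  obtain ⟨X, hX⟩ := hM.comp 0 φ ![]
  replace hX : ∀ x, atE x →
      (subE x X ↔ ¬ ∃ n, tp (lower x) k ![] = (succTp k)^[n] (emptyTp k 0)) := fun x hx => by
    rw [hX x hx, hφ]
    have e0 : (Fin.snoc ![] x : Fin 1 → M) 0 = x := Fin.snoc_last (α := fun _ => M) x ![]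
    have e1 : Fin.tail (Fin.snoc ![] x : Fin 1 → M) = ![] := Subsingleton.elim _ _
    simp only [e0, e1]
    simp
  by_contra hbad
  have hne : ¬ X = botE M := by
    intro h
    have := (hX a ha).2 hbad
    rw [h] at this
    exact ((hM.at_iff a).1 ha).1 (hM.eq_bot_of_subE this)
  obtain ⟨b, ⟨hb, hbX⟩, hmin⟩ := hM.least_in X hne
  refine (hX b hb).1 hbX ?_
  by_cases hex : ∃ c, atE c ∧ exleE c b
  · obtain ⟨c, ⟨⟨hc, -⟩, hcb⟩, hsucc⟩ := hM.pred b ⟨hb, hex⟩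
    have hcX : ¬ subE c X := fun h => hmin c ⟨hc, h⟩ hcb
    obtain ⟨n, hn⟩ := not_not.1 fun h => hcX ((hX c hc).2 h)
    have hC : ∀ x ∈ lower c, atE x ∧ exleE x b := by
      rintro x ⟨hx, hxc⟩
      refine ⟨hx, ?_⟩
      rcases hM.trich x c ⟨hx, hc⟩ with (h | rfl) | h
      · exact hM.lt_trans x c b ⟨⟨⟨⟨hx, hc⟩, hb⟩, h⟩, hcb⟩
      · exact hcb
      · exact (hxc h).elim
    have hl : lower b = insert b (lower c) := by
      ext x
      constructor
      · rintro ⟨hx, hbx⟩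
        by_cases hcx : exleE c x
        · exact Or.inl ((hsucc x ⟨hx, hcx⟩).resolve_right hbx)
        · exact Or.inr ⟨hx, hcx⟩
      · rintro (rfl | hx)
        · exact ⟨hb, hM.irrefl _ hb⟩
        · exact ⟨hx.1, fun h => hM.irrefl b hb
            (hM.lt_trans b x b ⟨⟨⟨⟨hb, hx.1⟩, hb⟩, h⟩, (hC x hx).2⟩)⟩
    refine ⟨n + 1, ?_⟩
    rw [hl, hM.tp_insert_nil hb hC, hn, Function.iterate_succ_apply']
  · have hl : lower b = insert b ∅ := by
      ext x
      constructor
      · rintro ⟨hx, hbx⟩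
        rcases hM.trich x b ⟨hx, hb⟩ with (h | h) | h
        exacts [(hex ⟨x, hx, h⟩).elim, Or.inl h, (hbx h).elim]
      · rintro (rfl | hx)
        exacts [⟨hb, hM.irrefl _ hb⟩, hx.elim]
    refine ⟨1, ?_⟩
    rw [hl, hM.tp_insert_nil hb (fun _ h => h.elim), tp_empty]
    rfl

theorem exists_tp_atoms (k : ℕ) : ∃ n, tp (atoms M) k ![] = (succTp k)^[n] (emptyTp k 0) := by
  by_cases h : ∃ a : M, atE a
  · obtain ⟨g, hg, hmax⟩ := hM.greatest h
    have : atoms M = lower g := Set.ext fun x => ⟨fun hx => ⟨hx, hmax x hx⟩, And.left⟩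
    rw [this]
    exact hM.exists_tp_lower k g hg
  · refine ⟨0, ?_⟩
    have : atoms M = ∅ := Set.eq_empty_iff_forall_notMem.2 fun x hx => h ⟨x, hx⟩
    rw [this, tp_empty]
    rfl

end FinAxioms

theorem tp_initial (n k : ℕ) : ∀ i ≤ n,
    tp {a : MSOn n | ∃ j : Fin n, (j : ℕ) < i ∧ a = {j}} k ![] = (succTp k)^[i] (emptyTp k 0)
  | 0, _ => by
    have : {a : MSOn n | ∃ j : Fin n, (j : ℕ) < 0 ∧ a = {j}} = ∅ := by simp
    rw [this, tp_empty]
    rfl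
  | i + 1, hi => by
    have e : {a : MSOn n | ∃ j : Fin n, (j : ℕ) < i + 1 ∧ a = {j}} =
        insert {⟨i, hi⟩} {a : MSOn n | ∃ j : Fin n, (j : ℕ) < i ∧ a = {j}} := by
      ext a
      simp only [Set.mem_ofPred_eq, Set.mem_insert_iff]
      constructor
      · rintro ⟨j, hj, rfl⟩
        rcases Nat.lt_succ_iff_lt_or_eq.1 hj with h | h
        · exact Or.inr ⟨j, h, rfl⟩
        · exact Or.inl (congrArg _ (Fin.ext h))
      · rintro (rfl | ⟨j, hj, rfl⟩)
        · exact ⟨_, Nat.lt_succ_self i, rfl⟩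
        · exact ⟨j, by omega, rfl⟩
    rw [e, (finAxioms_MSOn n).tp_insert_nil, tp_initial n k i (by omega),
      Function.iterate_succ_apply']
    · exact (atE_MSOn _).2 ⟨_, rfl⟩
    · rintro _ ⟨j, hj, rfl⟩
      exact ⟨(atE_MSOn _).2 ⟨_, rfl⟩, exleE_singleton _ _ |>.2 hj⟩

theorem tp_atoms_MSOn (n k : ℕ) :
    tp (atoms (MSOn n)) k ![] = (succTp k)^[n] (emptyTp k 0) := by
  rw [← tp_initial n k n le_rfl]
  congr 1
  ext a
  rw [atoms, Set.mem_ofPred_eq, atE_MSOn]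
  exact exists_congr fun j => ⟨fun h => ⟨j.2, h⟩, And.right⟩

/-! ### Transfer of sentences -/

theorem realize_sentence_of_tp_eq (hM : FinAxioms M) (hN : FinAxioms N) {k : ℕ}
    (h : tp (atoms M) k ![] = tp (atoms N) k ![]) (φ : Lmso.Sentence) (hφ : qr φ ≤ k) :
    M ⊨ φ ↔ N ⊨ φ := by
  have := realize_iff_of_tp_eq hM hN φ k ![] ![] hφ h
  rwa [Subsingleton.elim (![] : Fin 0 → M) default, Subsingleton.elim (![] : Fin 0 → N) default]
    at this

theorem FinAxioms.exists_MSOn_equiv (hM : FinAxioms M) (k : ℕ) :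
    ∃ n, ∀ φ : Lmso.Sentence, qr φ ≤ k → (M ⊨ φ ↔ MSOn n ⊨ φ) := by
  obtain ⟨n, hn⟩ := hM.exists_tp_atoms k
  exact ⟨n, realize_sentence_of_tp_eq hM (finAxioms_MSOn n) (hn.trans (tp_atoms_MSOn n k).symm)⟩

theorem MSOn_eventually_periodic (k : ℕ) : ∃ N d, 1 < d ∧ ∀ m n, N ≤ m → N ≤ n →
    m ≡ n [MOD d] → ∀ φ : Lmso.Sentence, qr φ ≤ k → (MSOn m ⊨ φ ↔ MSOn n ⊨ φ) := by
  set f : ℕ → Tp k 0 := fun n => (succTp k)^[n] (emptyTp k 0) with hf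
  obtain ⟨a, b, hab, hfab⟩ := Finite.exists_ne_map_eq_of_infinite f
  wlog hlt : a < b generalizing a b
  · exact this b a hab.symm hfab.symm (by omega)
  have hshift : ∀ c, f (a + c) = f (b + c) := fun c => by
    simp only [hf] at hfab ⊢
    rw [add_comm a, add_comm b, Function.iterate_add_apply, Function.iterate_add_apply, hfab]
  have hper : ∀ n, a ≤ n → ∀ q, f (n + q * (b - a)) = f n := by
    intro n hn q
    induction q with
    | zero => simp
    | succ q ih =>
      rw [← ih]
      have := hshift (n + q * (b - a) - a)
      rw [show a + (n + q * (b - a) - a) = n + q * (b - a) by omega,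
        show b + (n + q * (b - a) - a) = n + (q + 1) * (b - a) by
          rw [Nat.succ_mul]; omega] at this
      exact this.symm
  have main : ∀ m n, m ≤ n → a ≤ m → m ≡ n [MOD 2 * (b - a)] → f m = f n := by
    intro m n hmn ham h
    obtain ⟨q, hq⟩ := (Nat.modEq_iff_dvd' hmn).1 h
    rw [← hper m ham (2 * q)]
    congr 1
    rw [show 2 * q * (b - a) = 2 * (b - a) * q by ring, ← hq]
    omega
  refine ⟨a, 2 * (b - a), by omega, fun m n hm hn h φ hφ => ?_⟩
  refine realize_sentence_of_tp_eq (finAxioms_MSOn m) (finAxioms_MSOn n) ?_ φ hφ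
  rw [tp_atoms_MSOn, tp_atoms_MSOn]
  rcases le_total m n with h' | h'
  exacts [main m n h' hm h, (main n m h' hn h.symm).symm]

/-! ### The sentences `ρ_{d,h}` and `ψ_{>n}` -/

theorem realize_rho {d : ℕ} (h : ℕ) (hd : 0 < d) : M ⊨ rho d h ↔ ∃ A : Fin d → M,
    (∀ i, A i ≠ botE M) ∧ (∀ x, atE x → ∃ i, subE x (A i)) ∧
    (∀ i j : Fin d, i.val < j.val → ∀ x, atE x → ¬ (subE x (A i) ∧ subE x (A j))) ∧
    (∀ x, (atE x ∧ ∀ y, atE y → ¬ exleE y x) → subE x (A (aIdx d 1 hd))) ∧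
    (∀ j x y, subE x (A j) ∧ (((atE x ∧ atE y) ∧ exleE x y) ∧
      ∀ z, atE z ∧ exleE x z → z = y ∨ exleE y z) → subE y (A (cyc j))) ∧
    (∀ x, (atE x ∧ ∀ y, atE y → ¬ exleE x y) → subE x (A (aIdx d h hd))) := by
  rw [rho, dif_pos hd]
  refine BoundedFormula.realize_exs.trans (exists_congr fun A => ?_)
  simp only [BoundedFormula.realize_inf, and_assoc]
  refine and_congr (by simp) (and_congr (by simp) (and_congr ?_ (and_congr (by simp)
    (and_congr ?_ (by simp)))))
  · simp only [realize_bigAnd, List.mem_flatMap, List.mem_filterMap, List.mem_finRange, true_and,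
      forall_exists_index]
    constructor
    · intro H i j hij
      simpa using H _ i j (if_pos hij)
    · intro H φ i j e
      split_ifs at e with hij
      obtain rfl := Option.some_injective _ e
      simpa using H i j hij
  · simp only [realize_bigAnd, List.mem_map, List.mem_finRange, true_and, forall_exists_index,
      forall_apply_eq_imp_iff, BoundedFormula.realize_all, BoundedFormula.realize_imp,
      BoundedFormula.realize_inf, realize_sub', realize_isSuccOf, Fin.snoc_last, Fin.snoc_castSucc,
      and_assoc]

theorem singleton_subE_iff {n : ℕ} {i : Fin n} {X : MSOn n} : subE ({i} : MSOn n) X ↔ i ∈ X :=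
  Set.singleton_subset_iff

theorem realize_psiGt (n : ℕ) : M ⊨ psiGt n ↔
    ∃ v : Fin (n + 1) → M, (∀ i, atE (v i)) ∧ Function.Injective v := by
  refine BoundedFormula.realize_exs.trans (exists_congr fun v => ?_)
  simp only [BoundedFormula.realize_inf, realize_bigAnd, distinctPairs, List.mem_map,
    List.mem_finRange, true_and, forall_exists_index, forall_apply_eq_imp_iff, List.mem_flatMap,
    List.mem_filterMap, realize_at']
  refine and_congr_right fun _ => ⟨fun H i j hij => ?_, fun H φ i j e => ?_⟩
  · rcases lt_trichotomy i.val j.val with h | h | h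
    · have := H _ i j (if_pos h)
      simp [hij] at this
    · exact Fin.ext h
    · have := H _ j i (if_pos h)
      simp [hij] at this
  · split_ifs at e with hij
    obtain rfl := Option.some_injective _ e
    simp only [BoundedFormula.realize_not, realize_eq']
    exact fun h => hij.ne (congrArg _ (H h))

theorem modEq_of_realize_rho {n d h : ℕ} (hd : 0 < d) (H : MSOn n ⊨ rho d h) : n ≡ h [MOD d] := by
  obtain ⟨A, hne, -, hdis, hleast, hcyc, hgr⟩ := (realize_rho h hd).1 H
  have key : ∀ (i : ℕ) (hi : i < n), (⟨i, hi⟩ : Fin n) ∈ A ⟨i % d, Nat.mod_lt _ hd⟩ := by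
    intro i
    induction i with
    | zero =>
      intro hi
      have := hleast ({⟨0, hi⟩} : Set (Fin n)) ⟨⟨_, rfl⟩, by
        rintro _ ⟨j, rfl⟩
        rw [exleE_singleton]
        simp⟩
      simpa [aIdx] using this
    | succ i ih =>
      intro hi
      have hi' : i < n := by omega
      have := hcyc _ ({⟨i, hi'⟩} : Set (Fin n)) ({⟨i + 1, hi⟩} : Set (Fin n))
        ⟨singleton_subE_iff.2 (ih hi'), ⟨⟨⟨_, rfl⟩, ⟨_, rfl⟩⟩, by
          rw [exleE_singleton]; simp⟩, by
        rintro _ ⟨⟨j, rfl⟩, hj⟩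
        rw [exleE_singleton] at hj ⊢
        simp only [Set.singleton_eq_singleton_iff, Fin.ext_iff] at hj ⊢
        omega⟩
      simpa [cyc] using this
  have hn : 0 < n := by
    obtain ⟨x, -⟩ := Set.nonempty_iff_ne_empty.2 (hne ⟨0, hd⟩)
    exact x.pos
  have h1 := key (n - 1) (by omega)
  have h2 : (⟨n - 1, by omega⟩ : Fin n) ∈ A (aIdx d h hd) := by
    refine singleton_subE_iff.1 (hgr ({⟨n - 1, by omega⟩} : Set (Fin n)) ⟨⟨_, rfl⟩, ?_⟩)
    rintro _ ⟨j, rfl⟩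
    rw [exleE_singleton]
    simp only [not_lt]
    omega
  have hdis' : ∀ i j : Fin d, ∀ x : Fin n, x ∈ A i → x ∈ A j → ¬ i.val < j.val :=
    fun i j x hi hj h =>
    hdis i j h ({x} : Set (Fin n)) ⟨x, rfl⟩
      ⟨singleton_subE_iff.2 hi, singleton_subE_iff.2 hj⟩
  have heq : (n - 1) % d = (h + d - 1) % d :=
    le_antisymm (not_lt.1 (hdis' _ _ _ h2 h1)) (not_lt.1 (hdis' _ _ _ h1 h2))
  have h3 : n - 1 + 1 ≡ h + d - 1 + 1 [MOD d] := Nat.ModEq.add_right 1 heq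
  rw [Nat.sub_add_cancel hn, Nat.sub_add_cancel (by omega)] at h3
  exact h3.trans (by simp [Nat.ModEq])

theorem realize_rho_of_modEq {n d h : ℕ} (hd : 0 < d) (hdn : d ≤ n) (H : n ≡ h [MOD d]) :
    MSOn n ⊨ rho d h := by
  refine (realize_rho h hd).2 ⟨fun i => ({m | (m : ℕ) % d = i} : Set (Fin n)),
    ?_, ?_, ?_, ?_, ?_, ?_⟩
  · intro i
    refine Set.nonempty_iff_ne_empty.1 ⟨⟨i, by omega⟩, ?_⟩
    exact Nat.mod_eq_of_lt i.2
  · rintro _ ⟨x, rfl⟩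
    exact ⟨⟨x % d, Nat.mod_lt _ hd⟩, singleton_subE_iff.2 rfl⟩
  · rintro i j hij _ ⟨x, rfl⟩ ⟨hi, hj⟩
    have hi' : (x : ℕ) % d = i := singleton_subE_iff.1 hi
    have hj' : (x : ℕ) % d = j := singleton_subE_iff.1 hj
    omega
  · rintro _ ⟨⟨x, rfl⟩, hx⟩
    refine singleton_subE_iff.2 ?_
    have := hx ({⟨0, by omega⟩} : Set (Fin n)) ⟨_, rfl⟩
    rw [exleE_singleton] at this
    have h0 : (x : ℕ) = 0 := by simpa using this
    change (x : ℕ) % d = (1 + d - 1) % d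
    rw [h0, Nat.add_sub_cancel_left, Nat.mod_self, Nat.zero_mod]
  · rintro j _ _ ⟨hj, ⟨⟨⟨x, rfl⟩, ⟨y, rfl⟩⟩, hxy⟩, hs⟩
    have hj' : (x : ℕ) % d = j := singleton_subE_iff.1 hj
    rw [exleE_singleton] at hxy
    have := hs ({⟨x + 1, by omega⟩} : Set (Fin n)) ⟨⟨_, rfl⟩, by rw [exleE_singleton]; simp⟩
    rw [exleE_singleton] at this
    simp only [Set.singleton_eq_singleton_iff, Fin.ext_iff] at this
    have hy : (y : ℕ) = x + 1 := by omega
    refine singleton_subE_iff.2 ?_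
    change (y : ℕ) % d = (j + 1) % d
    rw [hy, ← hj', Nat.mod_add_mod]
  · rintro _ ⟨⟨x, rfl⟩, hx⟩
    refine singleton_subE_iff.2 ?_
    have := hx ({⟨n - 1, by omega⟩} : Set (Fin n)) ⟨_, rfl⟩
    rw [exleE_singleton] at this
    simp only [not_lt] at this
    have hxn : (x : ℕ) = n - 1 := by omega
    change (x : ℕ) % d = (h + d - 1) % d
    rw [hxn]
    refine Nat.ModEq.add_right_cancel' (n := d) 1 ?_
    rw [Nat.sub_add_cancel (by omega), Nat.sub_add_cancel (by omega)]
    exact H.trans (by simp [Nat.ModEq])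

theorem realize_psiGt_MSOn {m n : ℕ} : MSOn n ⊨ psiGt m ↔ m < n := by
  rw [realize_psiGt]
  constructor
  · rintro ⟨v, hv, hinj⟩
    simp only [atE_MSOn] at hv
    choose w hw using hv
    have : Function.Injective w := fun i j h => hinj (by rw [hw i, hw j, h])
    simpa using Fintype.card_le_of_injective w this
  · intro h
    refine ⟨fun i => ({⟨i, by omega⟩} : Set (Fin n)), fun i => ⟨_, rfl⟩, fun i j hij => ?_⟩
    have := Set.singleton_injective hij
    exact Fin.ext (Fin.mk.inj_iff.1 this)

theorem FinAxioms.infinite_atoms (hM : FinAxioms M) [Infinite M] : (atoms M).Infinite := by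
  intro hfin
  have hinj : Function.Injective fun X : M =>
      (⟨ext X, fun _ h => h.1⟩ : {S : Set M // S ⊆ atoms M}) :=
    fun X Y h => hM.eq_iff.2 (Subtype.ext_iff.1 h)
  have : Finite {S : Set M // S ⊆ atoms M} := hfin.finite_subsets.to_subtype
  exact not_finite_iff_infinite.2 ‹_› (Finite.of_injective _ hinj)

theorem FinAxioms.realize_psiGt (hM : FinAxioms M) [Infinite M] (n : ℕ) : M ⊨ psiGt n := by
  have := hM.infinite_atoms.to_subtype
  let e := Infinite.natEmbedding (atoms M)
  exact (MSO.realize_psiGt n).2 ⟨fun i => e i, fun i => (e i).2, fun i j h =>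
    Fin.ext (e.injective (Subtype.ext h))⟩

theorem modEq_of_forall_prime_pow {d a b : ℕ}
    (h : ∀ p j : ℕ, p.Prime → 1 ≤ j → p ^ j ∣ d → a ≡ b [MOD p ^ j]) : a ≡ b [MOD d] := by
  wlog hab : a ≤ b generalizing a b
  · exact (this (fun p j hp hj hd => (h p j hp hj hd).symm) (by omega)).symm
  rw [Nat.modEq_iff_dvd' hab, Nat.dvd_iff_prime_pow_dvd_dvd]
  intro p j hp hd
  rcases Nat.eq_zero_or_pos j with rfl | hj
  · simp
  · exact (Nat.modEq_iff_dvd' hab).1 (h p j hp hj hd)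

/-! ### The theories `T_r̃` -/

theorem Trt_isSatisfiable {rt : ℕ → ℕ} (hrt : IsResidueFunctionTilde rt) :
    (Trt rt).IsSatisfiable := by
  obtain ⟨r, -, hr⟩ := hrt
  let T : ℕ → Lmso.Theory := fun N => TMSOFin ∪ {σ | ∃ m ≤ N, σ = psiGt m} ∪
    {σ | ∃ d, (1 < d ∧ d ≤ N) ∧ σ = rho d (rt d)}
  have hT : Trt rt ⊆ ⋃ N, T N := by
    rintro σ ((h | ⟨m, rfl⟩) | ⟨d, hd, rfl⟩)
    · exact Set.mem_iUnion.2 ⟨0, Or.inl (Or.inl h)⟩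
    · exact Set.mem_iUnion.2 ⟨m, Or.inl (Or.inr ⟨m, le_rfl, rfl⟩)⟩
    · exact Set.mem_iUnion.2 ⟨d, Or.inr ⟨d, ⟨hd, le_rfl⟩, rfl⟩⟩
  have hmono : Monotone T := by
    rintro N N' h σ ((h' | ⟨m, hm, rfl⟩) | ⟨d, ⟨hd, hd'⟩, rfl⟩)
    · exact Or.inl (Or.inl h')
    · exact Or.inl (Or.inr ⟨m, hm.trans h, rfl⟩)
    · exact Or.inr ⟨d, ⟨hd, hd'.trans h⟩, rfl⟩
  refine Theory.IsSatisfiable.mono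
    ((Theory.isSatisfiable_directed_union_iff hmono.directed_le).2 fun N => ?_) hT
  have hD : 1 < (N + 2).factorial := Nat.one_lt_factorial.2 (by omega)
  set D := (N + 2).factorial
  set n := rt D + D * (N + 1) with hn
  have hNn : N < n := by
    have : 1 * (N + 1) ≤ D * (N + 1) := Nat.mul_le_mul_right _ hD.le
    omega
  have hmodel : MSOn n ⊨ T N := by
    rw [Theory.model_iff]
    rintro σ ((h | ⟨m, hm, rfl⟩) | ⟨d, ⟨hd, hd'⟩, rfl⟩)
    · exact Theory.model_iff _ |>.1 (model_TMSOFin_iff.2 (finAxioms_MSOn n)) σ h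
    · exact realize_psiGt_MSOn.2 (by omega)
    · refine realize_rho_of_modEq (by omega) (by omega) ?_
      have hdD : d ∣ D := Nat.dvd_factorial (by omega) (by omega)
      have h1 : rt D ≡ rt d [MOD d] := modEq_of_forall_prime_pow fun p j hp hj h =>
        ((hr D hD).2 p j hp hj (h.trans hdD)).trans ((hr d hd).2 p j hp hj h).symm
      have h2 : n ≡ rt D + 0 [MOD d] := Nat.ModEq.add_left _
        ((Nat.modEq_zero_iff_dvd).2 (hdD.mul_right _))
      exact h2.trans h1
  exact Theory.Model.isSatisfiable (MSOn n)

theorem FinAxioms.realize_iff (hM : FinAxioms M) (hN : FinAxioms N)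
    (hMpsi : ∀ n, M ⊨ psiGt n) (hNpsi : ∀ n, N ⊨ psiGt n)
    (hrho : ∀ d, 1 < d → ∃ h, M ⊨ rho d h ∧ N ⊨ rho d h) (φ : Lmso.Sentence) :
    M ⊨ φ ↔ N ⊨ φ := by
  obtain ⟨L, d, hd, hper⟩ := MSOn_eventually_periodic (qr φ)
  obtain ⟨h, hMh, hNh⟩ := hrho d hd
  set k := max (qr φ) (max (qr (rho d h)) (qr (psiGt L))) with hk
  have k1 : qr φ ≤ k := le_max_left _ _
  have k2 : qr (rho d h) ≤ k := (le_max_left _ _).trans (le_max_right _ _)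
  have k3 : qr (psiGt L) ≤ k := (le_max_right _ _).trans (le_max_right _ _)
  obtain ⟨m, hm⟩ := hM.exists_MSOn_equiv k
  obtain ⟨n, hn⟩ := hN.exists_MSOn_equiv k
  rw [hm φ k1, hn φ k1]
  refine hper m n (realize_psiGt_MSOn.1 ((hm _ k3).1 (hMpsi L))).le
    (realize_psiGt_MSOn.1 ((hn _ k3).1 (hNpsi L))).le ?_ φ le_rfl
  exact (modEq_of_realize_rho (by omega) ((hm _ k2).1 hMh)).trans
    (modEq_of_realize_rho (by omega) ((hn _ k2).1 hNh)).symm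

theorem FinAxioms.of_model_Trt {rt : ℕ → ℕ} (h : M ⊨ Trt rt) :
    FinAxioms M ∧ (∀ n, M ⊨ psiGt n) ∧ ∀ d, 1 < d → M ⊨ rho d (rt d) := by
  rw [Theory.model_iff] at h
  refine ⟨model_TMSOFin_iff.1 ((Theory.model_iff _).2 fun σ hσ => h σ (Or.inl (Or.inl hσ))),
    fun n => h _ (Or.inl (Or.inr ⟨n, rfl⟩)), fun d hd => h _ (Or.inr ⟨d, hd, rfl⟩)⟩

theorem Trt_isComplete {rt : ℕ → ℕ} (hrt : IsResidueFunctionTilde rt) : (Trt rt).IsComplete := by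
  refine ⟨Trt_isSatisfiable hrt, fun φ => ?_⟩
  obtain ⟨M⟩ := Trt_isSatisfiable hrt
  have key : ∀ N : Theory.ModelType.{0, 0, 0} (Trt rt), M ⊨ φ ↔ N ⊨ φ := fun N => by
    obtain ⟨h1, h2, h3⟩ := FinAxioms.of_model_Trt M.is_model
    obtain ⟨h4, h5, h6⟩ := FinAxioms.of_model_Trt N.is_model
    exact h1.realize_iff h4 h2 h5 (fun d hd => ⟨rt d, h3 d hd, h6 d hd⟩) φ
  by_cases h : M ⊨ φ
  · exact Or.inl (Theory.models_sentence_iff.2 fun N => (key N).1 h)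
  · exact Or.inr (Theory.models_sentence_iff.2 fun N =>
      (Sentence.realize_not N).2 fun h' => h ((key N).2 h'))

theorem FinAxioms.exists_realize_rho (hM : FinAxioms M) [Infinite M] {d : ℕ} (hd : 0 < d) :
    ∃ h < d, M ⊨ rho d h := by
  obtain ⟨n, hn⟩ := hM.exists_MSOn_equiv
    (max (qr (psiGt d)) ((Finset.range d).sup fun h => qr (rho d h)))
  have h1 := realize_psiGt_MSOn.1 ((hn _ (le_max_left _ _)).1 (hM.realize_psiGt d))
  refine ⟨n % d, Nat.mod_lt _ hd, (hn _ ?_).2 ?_⟩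
  · exact (Finset.le_sup (f := fun h => qr (rho d h))
      (Finset.mem_range.2 (Nat.mod_lt n hd))).trans (le_max_right _ _)
  · exact realize_rho_of_modEq hd h1.le (Nat.mod_modEq n d).symm

theorem FinAxioms.modEq_of_realize_rho (hM : FinAxioms M) {d e h g : ℕ} (hd : 0 < d) (he : 0 < e)
    (hed : e ∣ d) (h1 : M ⊨ rho d h) (h2 : M ⊨ rho e g) : h ≡ g [MOD e] := by
  obtain ⟨n, hn⟩ := hM.exists_MSOn_equiv (max (qr (rho d h)) (qr (rho e g)))
  have h3 := MSO.modEq_of_realize_rho hd ((hn _ (le_max_left _ _)).1 h1)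
  have h4 := MSO.modEq_of_realize_rho he ((hn _ (le_max_right _ _)).1 h2)
  exact (h3.of_dvd hed).symm.trans h4

theorem FinAxioms.exists_model_Trt (hM : FinAxioms M) [Infinite M] :
    ∃ rt, IsResidueFunctionTilde rt ∧ M ⊨ Trt rt := by
  have hex : ∀ d : ℕ, ∃ h, 0 < d → h < d ∧ M ⊨ rho d h := fun d => by
    by_cases hd : 0 < d
    · obtain ⟨h, hh⟩ := hM.exists_realize_rho hd
      exact ⟨h, fun _ => hh⟩
    · exact ⟨0, fun h => (hd h).elim⟩
  choose rt hrt using hex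
  have hcompat : ∀ d e, 0 < d → 0 < e → e ∣ d → rt d ≡ rt e [MOD e] := fun d e hd he hed =>
    hM.modEq_of_realize_rho hd he hed (hrt d hd).2 (hrt e he).2
  refine ⟨rt, ⟨fun p j => rt (p ^ j), fun p j hp _ => ⟨(hrt _ (pow_pos hp.pos j)).1,
    hcompat _ _ (pow_pos hp.pos _) (pow_pos hp.pos _) (pow_dvd_pow p j.le_succ)⟩,
    fun d hd => ⟨(hrt d (by omega)).1, fun p j hp _ h =>
      hcompat _ _ (by omega) (pow_pos hp.pos _) h⟩⟩, ?_⟩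
  rw [Theory.model_iff]
  rintro σ ((h | ⟨m, rfl⟩) | ⟨d, hd, rfl⟩)
  · exact (Theory.model_iff _).1 (model_TMSOFin_iff.2 hM) σ h
  · exact hM.realize_psiGt m
  · exact (hrt d (by omega)).2

end

theorem statement16 :
    (∀ rt : ℕ → ℕ, IsResidueFunctionTilde rt →
      (Trt rt).IsSatisfiable ∧ ∀ φ : Lmso.Sentence, Trt rt ⊨ᵇ φ ∨ Trt rt ⊨ᵇ ∼φ) ∧
    (∀ T : Lmso.Theory, T.IsComplete → TMSOFin ⊆ T →
      (∃ (M : Type) (_ : Lmso.Structure M), Theory.Model M T ∧ Infinite M) →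
      ∃ rt : ℕ → ℕ, IsResidueFunctionTilde rt ∧
        ∀ φ : Lmso.Sentence, (T ⊨ᵇ φ ↔ Trt rt ⊨ᵇ φ)) := by
  refine ⟨fun rt hrt => Trt_isComplete hrt, ?_⟩
  rintro T hT hsub ⟨M, _, hMT, hinf⟩
  have hM : FinAxioms M := model_TMSOFin_iff.1 (hMT.mono hsub)
  obtain ⟨rt, hrt, hmodel⟩ := hM.exists_model_Trt
  exact ⟨rt, hrt, fun φ => (hT.realize_sentence_iff φ M).symm.trans
    ((Trt_isComplete hrt).realize_sentence_iff φ M)⟩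

end MSO
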